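/- arXiv:math/0601141 — 2 statements merged into one kernel-verified Lean document; each statement's English description precedes it below -/
import Mathlib

section
/- Let X be a geometrically integral curve over a perfect field k and let d be a positive integer. A subfield of k(X) generated over k by one or more elements each of degree d (an element f has degree d if [k(X) : k(f)] = d) is d-controlled. -/
open IntermediateField

/-- The gonality of the function field `F` of a curve over `k`: the smallest degree
`[F : k(f)]` of a nonconstant rational function `f ∈ F`, i.e. the smallest degree of a
dominant rational map from the curve to `ℙ¹_k`. -/
noncomputable def gonality (k F : Type*) [Field k] [Field F] [Algebra k F] : ℕ :=
  sInf {d : ℕ | ∃ f : F, Transcendental k f ∧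
    Module.finrank (IntermediateField.adjoin k {f}) F = d}

/-- `F` is the function field of a curve over `k`: a finitely generated field extension of
transcendence degree 1, i.e. a finite extension of some `k(x)` with `x` transcendental. -/
def IsFunctionField (k F : Type*) [Field k] [Field F] [Algebra k F] : Prop :=
  ∃ x : F, Transcendental k x ∧
    FiniteDimensional (IntermediateField.adjoin k {x}) F

/-- A place of the function field `F/k`: a valuation subring of `F` containing `k`
and different from `F` itself.  These correspond to the closed points of the smooth
projective model of the curve. -/
structure FFPlace (k F : Type*) [Field k] [Field F] [Algebra k F] where
  asSubring : ValuationSubring F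
  algebraMap_mem : ∀ a : k, algebraMap k F a ∈ asSubring
  ne_top : asSubring ≠ ⊤

variable (k F : Type*) [Field k] [Field F] [Algebra k F]

/-- The degree of a place: the `k`-dimension of its residue field. -/
noncomputable def FFPlace.degree (P : FFPlace k F) : ℕ :=
  letI : Algebra k (IsLocalRing.ResidueField P.asSubring) :=
    ((IsLocalRing.residue (P.asSubring : Type _)).comp
      ((algebraMap k F).codRestrict P.asSubring.toSubring P.algebraMap_mem)).toAlgebra
  Module.finrank k (IsLocalRing.ResidueField P.asSubring)

/-- The space of adeles (repartitions) of `F/k`: families `(α_P)_P` indexed by the places of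
`F/k` with `α_P` integral at all but finitely many places, as a `k`-submodule of `Π_P F`. -/
def adeleSubmodule : Submodule k (FFPlace k F → F) where
  carrier := {α | {P : FFPlace k F | α P ∉ P.asSubring}.Finite}
  zero_mem' := by
    show {P : FFPlace k F | (0 : F) ∉ P.asSubring}.Finite
    convert Set.finite_empty using 2
    ext P
    simp [zero_mem]
  add_mem' := by
    intro a b ha hb
    refine Set.Finite.subset (ha.union hb) ?_
    intro P hP
    rw [Set.mem_union]
    by_contra h
    push_neg at h
    simp only [Set.mem_setOf_eq, not_not] at h
    exact hP (add_mem h.1 h.2)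
  smul_mem' := by
    intro c α hα
    refine Set.Finite.subset hα ?_
    intro P hP
    by_contra h
    simp only [Set.mem_setOf_eq, not_not] at h
    refine hP ?_
    show c • α P ∈ P.asSubring
    rw [Algebra.smul_def]
    exact mul_mem (P.algebraMap_mem c) h

/-- The adeles that are integral at every place. -/
def integralAdeles : Submodule k (FFPlace k F → F) where
  carrier := {α | ∀ P : FFPlace k F, α P ∈ P.asSubring}
  zero_mem' := fun P => zero_mem _
  add_mem' := fun ha hb P => add_mem (ha P) (hb P)
  smul_mem' := by
    intro c α hα P
    show c • α P ∈ P.asSubring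
    rw [Algebra.smul_def]
    exact mul_mem (P.algebraMap_mem c) (hα P)

/-- The principal adeles: the diagonal image of `F`. -/
def principalAdeles : Submodule k (FFPlace k F → F) :=
  LinearMap.range (LinearMap.pi fun _ : FFPlace k F => (LinearMap.id : F →ₗ[k] F))

/-- The genus of the function field `F/k`, defined à la Chevalley/Weil as the `k`-dimension of
`A / (A(0) + F)`, where `A` is the space of adeles, `A(0)` the everywhere-integral ones and `F`
the principal ones.  For the function field of a geometrically integral smooth projective curve
this is the usual genus. -/
noncomputable def genus : ℕ :=
  Module.finrank k
    (↥(adeleSubmodule k F) ⧸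
      ((integralAdeles k F ⊔ principalAdeles k F).comap (adeleSubmodule k F).subtype))

/-- `E` is a `d`-controlled subfield of `F`: `[F : E] = d/e` for some positive integer `e`
dividing `d`, and the genus of `E` is at most `(e-1)²`. -/
def IsDControlled (d : ℕ) (E : IntermediateField k F) : Prop :=
  ∃ e : ℕ, 0 < e ∧ e * Module.finrank E F = d ∧ genus k E ≤ (e - 1) ^ 2

section

open Polynomial

theorem finrank_le_finrank_mul_natDegree_add {k F U : Type*} [Field k] [Field F] [Algebra k F]
    {t : F} (ht : Transcendental k t) [FiniteDimensional k⟮t⟯ F] {p : k[X]} (hp : p ≠ 0)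
    [AddCommGroup U] [Module k U] [FiniteDimensional k U] (φ : U →ₗ[k] F) (M : Submodule k F)
    (hM : ∀ f ∈ M, t * f ∈ M) (hφ : ∀ u, φ u ∈ M) (N : Submodule k U)
    (hN : ∀ u, ∀ f ∈ M, φ u = aeval t p * f → u ∈ N) :
    Module.finrank k U ≤ Module.finrank k⟮t⟯ F * p.natDegree + Module.finrank k N := by
  let _ : Algebra k[X] k⟮t⟯ := (aeval (AdjoinSimple.gen k t)).toAlgebra
  let _ : Algebra k[X] F := (aeval t).toAlgebra
  have algF (q : k[X]) : algebraMap k[X] F q = aeval t q := rfl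
  have algK (q : k[X]) : algebraMap k⟮t⟯ F (algebraMap k[X] k⟮t⟯ q) = aeval t q := by
    change algebraMap k⟮t⟯ F (aeval (AdjoinSimple.gen k t) q) = _
    rw [← aeval_algebraMap_apply, AdjoinSimple.algebraMap_gen]
  have : IsScalarTower k[X] k⟮t⟯ F := .of_algebraMap_eq fun q ↦ (algK q).symm
  have : IsScalarTower k k[X] F := .of_algebraMap_eq fun a ↦ by simp [algF]
  have injF : Function.Injective (algebraMap k[X] F) := transcendental_iff_injective.mp ht
  have : FaithfulSMul k[X] F := (faithfulSMul_iff_algebraMap_injective _ _).mpr injF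
  have : FaithfulSMul k[X] k⟮t⟯ := (faithfulSMul_iff_algebraMap_injective _ _).mpr fun a b h ↦
    injF (by rw [algF, algF, ← algK, ← algK, h])
  have : IsFractionRing k[X] k⟮t⟯ := .of_field _ _ fun ⟨x, hx⟩ ↦ by
    obtain ⟨r, s, rfl⟩ := mem_adjoin_simple_iff k x |>.mp hx
    exact ⟨r, s, Subtype.ext (by
      change _ = algebraMap k⟮t⟯ F (algebraMap k[X] k⟮t⟯ r / algebraMap k[X] k⟮t⟯ s)
      rw [map_div₀, algK, algK])⟩
  let L : Submodule k[X] F := Submodule.span k[X] (φ.range : Set F)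
  have : Module.Finite k[X] L := by
    obtain ⟨s, hs⟩ := Module.Finite.iff_fg.mp (inferInstance : Module.Finite k φ.range)
    refine Module.Finite.iff_fg.mpr ⟨s, ?_⟩
    change _ = Submodule.span k[X] (φ.range : Set F)
    rw [← hs, Submodule.span_span_of_tower]
  have hLM : ∀ f ∈ L, f ∈ M := by
    intro f hf
    refine Submodule.span_induction (p := fun f _ ↦ f ∈ M) ?_ M.zero_mem
      (fun _ _ _ _ ↦ M.add_mem) ?_ hf
    · rintro _ ⟨u, rfl⟩
      exact hφ u
    · intro q f hf' hf
      clear hf'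
      rw [Algebra.smul_def, algF]
      induction q using Polynomial.induction_on generalizing f with
      | C a => simpa [Algebra.smul_def] using M.smul_mem a hf
      | add p q hp hq => simpa [add_mul] using M.add_mem (hp f hf) (hq f hf)
      | monomial n a ih =>
        have := ih _ (hM f hf)
        simpa [pow_succ, mul_assoc] using this
  have : Module.IsTorsionFree k[X] L := inferInstance
  let b := Module.finBasis k[X] L
  have hr : Module.finrank k[X] L ≤ Module.finrank k⟮t⟯ F := by
    have h1 : LinearIndependent k[X] (fun i ↦ (b i : F)) :=
      b.linearIndependent.map' L.subtype (Submodule.ker_subtype L)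
    rw [LinearIndependent.iff_fractionRing (R := k[X]) (K := k⟮t⟯)] at h1
    simpa using h1.fintype_card_le_finrank
  let φ' : U →ₗ[k] L := φ.codRestrict (L.restrictScalars k) fun u ↦ Submodule.subset_span ⟨u, rfl⟩
  let θ : U →ₗ[k] (Fin (Module.finrank k[X] L) → k[X] ⧸ Ideal.span {p}) :=
    LinearMap.pi fun i ↦ (Ideal.Quotient.mkₐ k (Ideal.span {p})).toLinearMap ∘ₗ
      ((b.coord i).restrictScalars k) ∘ₗ φ'
  have hker : LinearMap.ker θ ≤ N := by
    intro u hu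
    have h1 : ∀ i, ∃ c, b.repr (φ' u) i = p * c := fun i ↦ by
      have := congrFun (LinearMap.mem_ker.mp hu) i
      have : (Ideal.Quotient.mk (Ideal.span {p})) (b.repr (φ' u) i) = 0 := this
      rwa [Ideal.Quotient.eq_zero_iff_mem, Ideal.mem_span_singleton] at this
    choose c hc using h1
    refine hN u (∑ i, c i • b i : L) (hLM _ (Subtype.mem _)) ?_
    have h2 : φ' u = p • ∑ i, c i • b i := by
      conv_lhs => rw [← b.sum_repr (φ' u)]
      simp only [hc, Finset.smul_sum, smul_smul]
    have h3 := congrArg (Subtype.val) h2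
    rw [← algF, ← Algebra.smul_def]
    exact h3
  have : Module.Finite k (k[X] ⧸ Ideal.span {p}) := by
    exact (AdjoinRoot.powerBasis hp).finite
  have h4 := θ.finrank_range_add_finrank_ker
  have h5 : Module.finrank k θ.range ≤ Module.finrank k[X] L * p.natDegree := by
    refine (Submodule.finrank_le _).trans ?_
    rw [Module.finrank_pi_fintype]
    simp [finrank_quotient_span_eq_natDegree]
  have h6 := Submodule.finrank_mono hker
  have h7 := Nat.mul_le_mul_right p.natDegree hr
  omega

section Places

variable {k F}

/-- The valuation attached to a place. -/
noncomputable abbrev FFPlace.val (P : FFPlace k F) : Valuation F P.asSubring.ValueGroup :=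
  P.asSubring.valuation

namespace FFPlace

theorem val_le_one_iff (P : FFPlace k F) (f : F) : P.val f ≤ 1 ↔ f ∈ P.asSubring :=
  P.asSubring.valuation_le_one_iff f

theorem val_algebraMap_le (P : FFPlace k F) (a : k) : P.val (algebraMap k F a) ≤ 1 :=
  (P.val_le_one_iff _).mpr (P.algebraMap_mem a)

theorem val_algebraMap (P : FFPlace k F) {a : k} (ha : a ≠ 0) : P.val (algebraMap k F a) = 1 := by
  refine le_antisymm (P.val_algebraMap_le a) ?_
  have h := P.val_algebraMap_le a⁻¹
  rw [map_inv₀, map_inv₀] at h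
  have h0 : P.val (algebraMap k F a) ≠ 0 := by simpa using ha
  rwa [inv_le_one₀ (zero_lt_iff.mpr h0)] at h

theorem val_smul_le (P : FFPlace k F) (a : k) (f : F) : P.val (a • f) ≤ P.val f := by
  rw [Algebra.smul_def, map_mul]
  exact mul_le_of_le_one_left' (P.val_algebraMap_le a)

theorem val_le_one_of_isIntegral (P : FFPlace k F) {A : Subalgebra k F}
    (hA : ∀ a ∈ A, P.val a ≤ 1) {f : F} (hf : IsIntegral A f) : P.val f ≤ 1 := by
  let _ : Algebra A P.asSubring :=
    (Subring.inclusion (S := A.toSubring) (T := P.asSubring.toSubring)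
      fun a ha ↦ (P.val_le_one_iff a).mp (hA a ha)).toAlgebra
  have : IsScalarTower A P.asSubring F := .of_algebraMap_eq fun _ ↦ rfl
  obtain ⟨y, rfl⟩ := IsIntegrallyClosed.isIntegral_iff.mp (hf.tower_top (A := P.asSubring))
  exact (P.val_le_one_iff _).mpr y.2

theorem val_le_one_of_isAlgebraic (P : FFPlace k F) {f : F} (hf : IsAlgebraic k f) :
    P.val f ≤ 1 := by
  refine P.val_le_one_of_isIntegral (A := ⊥) ?_ (hf.isIntegral.tower_top)
  rintro _ ⟨a, rfl⟩
  exact P.val_algebraMap_le a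

theorem transcendental_of_val_lt_one (P : FFPlace k F) {t : F} (ht : t ≠ 0) (h : P.val t < 1) :
    Transcendental k t := by
  intro halg
  have h1 := P.val_le_one_of_isAlgebraic halg.inv
  rw [map_inv₀, inv_le_one₀ (zero_lt_iff.mpr (by simpa using ht))] at h1
  exact h.not_ge h1

theorem val_aeval_le_one (P : FFPlace k F) {t : F} (ht : P.val t ≤ 1) (q : k[X]) :
    P.val (aeval t q) ≤ 1 := by
  have h : Algebra.adjoin k {t} ≤
      { P.asSubring.toSubring with algebraMap_mem' := P.algebraMap_mem } :=
    Algebra.adjoin_le (by simpa using (P.val_le_one_iff t).mp ht)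
  exact (P.val_le_one_iff _).mpr (h (aeval_mem_adjoin_singleton k t))

theorem val_aeval_eq_one (P : FFPlace k F) {t : F} (ht : P.val t < 1) {q : k[X]}
    (hq : q.coeff 0 ≠ 0) : P.val (aeval t q) = 1 := by
  have h : P.val (t * aeval t q.divX) < P.val (algebraMap k F (q.coeff 0)) := by
    rw [P.val_algebraMap hq, map_mul]
    exact mul_lt_one_of_lt_of_le ht (P.val_aeval_le_one ht.le _)
  rw [← X_mul_divX_add q, map_add, map_mul, aeval_X, aeval_C,
    Valuation.map_add_eq_of_lt_right _ h, P.val_algebraMap hq]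

theorem exists_val_aeval_mul_le_one (t : F) [Algebra.IsAlgebraic k⟮t⟯ F] (f : F) :
    ∃ q : k[X], aeval t q ≠ 0 ∧ ∀ P : FFPlace k F, P.val t ≤ 1 → P.val (aeval t q * f) ≤ 1 := by
  open algebraAdjoinAdjoin in
  have : Algebra.IsAlgebraic (Algebra.adjoin k {t}) F :=
    Algebra.IsAlgebraic.trans _ k⟮t⟯ _
  obtain ⟨⟨y, hy⟩, hy0, hint⟩ :=
    (Algebra.IsAlgebraic.isAlgebraic (R := Algebra.adjoin k {t}) f).exists_integral_multiple
  rw [Algebra.adjoin_singleton_eq_range_aeval] at hy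
  obtain ⟨q, rfl⟩ := hy
  refine ⟨q, fun h ↦ hy0 (Subtype.ext h), fun P hP ↦ P.val_le_one_of_isIntegral ?_ hint⟩
  intro a ha
  rw [Algebra.adjoin_singleton_eq_range_aeval] at ha
  obtain ⟨q, rfl⟩ := ha
  exact P.val_aeval_le_one hP q

theorem exists_forall_val_pow_mul_lt_one
    (hF : ∀ t : F, Transcendental k t → Algebra.IsAlgebraic k⟮t⟯ F) (P : FFPlace k F) {t : F}
    (ht : P.val t < 1) (f : F) : ∃ N₀, ∀ N ≥ N₀, P.val (t ^ N * f) < 1 := by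
  obtain rfl | ht0 := eq_or_ne t 0
  · exact ⟨1, fun N hN ↦ by simp [show N ≠ 0 by omega]⟩
  have := hF t (P.transcendental_of_val_lt_one ht0 ht)
  obtain ⟨q, hq0, hq⟩ := exists_val_aeval_mul_le_one (k := k) t f
  have hq0' : q ≠ 0 := by rintro rfl; simp at hq0
  obtain ⟨r, hr, hr0⟩ := q.exists_eq_pow_rootMultiplicity_mul_and_not_dvd hq0' 0
  set m := q.rootMultiplicity 0
  rw [C_0, sub_zero] at hr hr0
  have hr0 : r.coeff 0 ≠ 0 := by rwa [X_dvd_iff] at hr0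
  have h1 := hq P ht.le
  rw [hr, map_mul (aeval t), map_pow (aeval t), aeval_X, mul_right_comm,
    map_mul, P.val_aeval_eq_one ht hr0, mul_one] at h1
  refine ⟨m + 1, fun N hN ↦ ?_⟩
  obtain ⟨j, rfl⟩ := Nat.exists_eq_add_of_le hN
  rw [show t ^ (m + 1 + j) * f = t ^ (j + 1) * (t ^ m * f) by ring, map_mul, map_pow]
  exact mul_lt_one_of_lt_of_le (pow_lt_one₀ zero_le ht (by omega)) h1

theorem not_le_of_ne (hF : ∀ t : F, Transcendental k t → Algebra.IsAlgebraic k⟮t⟯ F)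
    {P Q : FFPlace k F} (hPQ : P ≠ Q) : ∃ a, P.val a ≤ 1 ∧ 1 < Q.val a := by
  by_contra! h
  have hne : ¬ ∀ f, Q.val f ≤ 1 → P.val f ≤ 1 := by
    intro h'
    apply hPQ
    cases P with | mk A _ _ => cases Q with | mk B _ _ =>
    congr
    ext f
    rw [← A.valuation_le_one_iff, ← B.valuation_le_one_iff]
    exact ⟨h f, h' f⟩
  push Not at hne
  obtain ⟨f, hf, hf'⟩ := hne
  have hs : P.val f⁻¹ < 1 := by rw [map_inv₀]; exact inv_lt_one_of_one_lt₀ hf'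
  have hf0 : f ≠ 0 := by rintro rfl; simp at hf'
  apply Q.ne_top
  rw [eq_top_iff]
  intro g _
  rw [← Q.val_le_one_iff]
  obtain ⟨N, hN⟩ := exists_forall_val_pow_mul_lt_one hF P hs g
  have h1 := h _ (hN N le_rfl).le
  have h2 : g = f ^ N * (f⁻¹ ^ N * g) := by
    rw [← mul_assoc, ← mul_pow, mul_inv_cancel₀ hf0, one_pow, one_mul]
  rw [h2, map_mul, map_pow]
  exact mul_le_one' (pow_le_one' hf _) h1

theorem exists_one_lt_val_and_val_lt_one
    (hF : ∀ t : F, Transcendental k t → Algebra.IsAlgebraic k⟮t⟯ F)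
    {P Q : FFPlace k F} (hPQ : P ≠ Q) : ∃ u, 1 < P.val u ∧ Q.val u < 1 := by
  obtain ⟨a, ha, ha'⟩ := not_le_of_ne hF hPQ
  obtain ⟨b, hb, hb'⟩ := not_le_of_ne hF hPQ.symm
  have hpos : 0 < Q.val a := zero_lt_one.trans ha'
  have ha0 : a ≠ 0 := by rintro rfl; simp at ha'
  refine ⟨b / a, ?_, ?_⟩
  · rw [map_div₀, one_lt_div₀ (zero_lt_iff.mpr (by simpa using ha0))]
    exact ha.trans_lt hb'
  · rw [map_div₀, div_lt_one₀ hpos]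
    exact hb.trans_lt ha'

theorem val_one_add_eq_one (P : FFPlace k F) {z : F} (hz : P.val z < 1) : P.val (1 + z) = 1 := by
  rw [Valuation.map_add_eq_of_lt_left _ (by simpa using hz), map_one]

theorem val_one_add_eq (P : FFPlace k F) {z : F} (hz : 1 < P.val z) : P.val (1 + z) = P.val z := by
  rw [Valuation.map_add_eq_of_lt_right _ (by simpa using hz)]

open Classical in
theorem exists_one_lt_val_and_forall_val_lt_one
    (hF : ∀ t : F, Transcendental k t → Algebra.IsAlgebraic k⟮t⟯ F)
    (P : FFPlace k F) (T : Finset (FFPlace k F)) (hP : P ∉ T) :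
    ∃ z, 1 < P.val z ∧ ∀ Q ∈ T, Q.val z < 1 := by
  induction T using Finset.induction_on with
  | empty =>
    obtain ⟨z, hz⟩ : ∃ z, z ∉ P.asSubring := by
      by_contra! h
      exact P.ne_top (eq_top_iff.mpr fun z _ ↦ h z)
    rw [← P.val_le_one_iff, not_le] at hz
    exact ⟨z, hz, by simp⟩
  | insert Q T hQ ih =>
    rw [Finset.mem_insert, not_or] at hP
    obtain ⟨z, hz, hzT⟩ := ih hP.2
    obtain ⟨u, hu, huQ⟩ := exists_one_lt_val_and_val_lt_one hF hP.1
    choose! N hN using fun R : T ↦ exists_forall_val_pow_mul_lt_one hF R.1 (hzT R.1 R.2) u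
    let n := T.attach.sup N + 1
    have hn : ∀ R ∈ T, R.val (z ^ n * u) < 1 := fun R hR ↦ hN ⟨R, hR⟩ n
      ((Finset.le_sup (f := N) (Finset.mem_attach T ⟨R, hR⟩)).trans (Nat.le_succ _))
    have hn0 : n ≠ 0 := Nat.succ_ne_zero _
    rcases le_or_gt (Q.val z) 1 with hzQ | hzQ
    · refine ⟨z ^ n * u, ?_, ?_⟩
      · rw [map_mul, map_pow]
        exact one_lt_mul'' (one_lt_pow₀ hz hn0) hu
      · simp only [Finset.mem_insert, forall_eq_or_imp]
        refine ⟨?_, hn⟩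
        rw [map_mul, map_pow]
        rw [mul_comm]
        exact mul_lt_one_of_lt_of_le huQ (pow_le_one' hzQ n)
    · have key : ∀ R : FFPlace k F, 1 < R.val z → R.val (z ^ n / (1 + z ^ n) * u) = R.val u := by
        intro R hR
        have h1 : 1 < R.val (z ^ n) := by rw [map_pow]; exact one_lt_pow₀ hR hn0
        rw [map_mul, map_div₀, R.val_one_add_eq h1, div_self (zero_lt_one.trans h1).ne', one_mul]
      refine ⟨z ^ n / (1 + z ^ n) * u, (key P hz).symm ▸ hu, ?_⟩
      simp only [Finset.mem_insert, forall_eq_or_imp]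
      refine ⟨(key Q hzQ).symm ▸ huQ, fun R hR ↦ ?_⟩
      have h1 : R.val (z ^ n) < 1 := by rw [map_pow]; exact pow_lt_one₀ zero_le (hzT R hR) hn0
      rw [div_mul_eq_mul_div, map_div₀, R.val_one_add_eq_one h1, div_one]
      exact hn R hR

theorem exists_val_one_sub_mul_le_one
    (hF : ∀ t : F, Transcendental k t → Algebra.IsAlgebraic k⟮t⟯ F)
    (P : FFPlace k F) (T : Finset (FFPlace k F)) (hP : P ∉ T) (c : F) :
    ∃ w, P.val (w * c - c) ≤ 1 ∧ ∀ Q ∈ T, Q.val (w * c) ≤ 1 := by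
  obtain ⟨z, hz, hzT⟩ := exists_one_lt_val_and_forall_val_lt_one hF P T hP
  have hz0 : z ≠ 0 := by rintro rfl; simp at hz
  choose! N hN using fun R : T ↦ exists_forall_val_pow_mul_lt_one hF R.1 (hzT R.1 R.2) c
  have hz' : P.val z⁻¹ < 1 := by rw [map_inv₀]; exact inv_lt_one_of_one_lt₀ hz
  obtain ⟨N', hN'⟩ := exists_forall_val_pow_mul_lt_one hF P hz' c
  let n := T.attach.sup N + N' + 1
  have hn0 : n ≠ 0 := Nat.succ_ne_zero _
  refine ⟨z ^ n / (1 + z ^ n), ?_, fun R hR ↦ ?_⟩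
  · have h1 : 1 < P.val (z ^ n) := by rw [map_pow]; exact one_lt_pow₀ hz hn0
    have h2 : (1 + z ^ n) ≠ 0 := by
      intro h
      have := P.val_one_add_eq h1
      rw [h, map_zero] at this
      exact not_lt_zero (this ▸ h1)
    rw [show z ^ n / (1 + z ^ n) * c - c = -(c / (1 + z ^ n)) by field_simp; ring,
      Valuation.map_neg, map_div₀, P.val_one_add_eq h1, ← map_div₀, div_eq_inv_mul, ← inv_pow]
    exact (hN' n (by omega)).le
  · have h1 : R.val (z ^ n) < 1 := by rw [map_pow]; exact pow_lt_one₀ zero_le (hzT R hR) hn0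
    rw [div_mul_eq_mul_div, map_div₀, R.val_one_add_eq_one h1, div_one]
    have := Finset.le_sup (f := N) (Finset.mem_attach T ⟨R, hR⟩)
    exact (hN ⟨R, hR⟩ n (by omega)).le

open Classical in
/-- Weak approximation for places. -/
theorem exists_forall_val_sub_le_one
    (hF : ∀ t : F, Transcendental k t → Algebra.IsAlgebraic k⟮t⟯ F)
    (T : Finset (FFPlace k F)) (c : FFPlace k F → F) :
    ∃ f, ∀ P ∈ T, P.val (f - c P) ≤ 1 := by
  choose w hw hw' using fun P : FFPlace k F ↦
    exists_val_one_sub_mul_le_one hF P (T.erase P) (Finset.notMem_erase P T) (c P)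
  refine ⟨∑ P ∈ T, w P * c P, fun P hP ↦ ?_⟩
  rw [← Finset.add_sum_erase T _ hP, add_sub_right_comm]
  refine (Valuation.map_add _ _ _).trans (max_le (hw P) (Valuation.map_sum_le _ fun Q hQ ↦ ?_))
  obtain ⟨hne, hQ⟩ := Finset.mem_erase.mp hQ
  exact hw' Q P (Finset.mem_erase.mpr ⟨hne.symm, hP⟩)

end FFPlace

end Places

section RiemannRoch

variable {k F}

namespace FFPlace

theorem isAlgebraic_of_forall_val_le_one {f : F} (hf : ∀ P : FFPlace k F, P.val f ≤ 1) :
    IsAlgebraic k f := by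
  by_contra halg
  have hf' : f ∉ (integralClosure k F).toSubring := fun h ↦ halg (IsIntegral.isAlgebraic h)
  have : IsIntegrallyClosedIn (integralClosure k F).toSubring F :=
    inferInstanceAs (IsIntegrallyClosedIn (integralClosure k F) F)
  obtain ⟨V, hV, hfV⟩ := Subring.exists_le_valuationSubring_of_isIntegrallyClosedIn hf'
  let P : FFPlace k F := ⟨V, fun a ↦ hV ((integralClosure k F).algebraMap_mem a),
    fun h ↦ hfV (h ▸ ValuationSubring.mem_top f)⟩
  exact hfV ((P.val_le_one_iff f).mp (hf P))

theorem val_aeval_eq_pow (P : FFPlace k F) {x : F} (hx : 1 < P.val x) {q : k[X]} (hq : q ≠ 0) :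
    P.val (aeval x q) = P.val x ^ q.natDegree := by
  have hx0 : x ≠ 0 := by rintro rfl; simp at hx
  let _ := invertibleOfNonzero hx0
  rw [aeval_def, ← eval₂_reverse_mul_pow, invOf_eq_inv, ← aeval_def, map_mul, map_pow,
    P.val_aeval_eq_one _ (by simpa using hq), one_mul]
  rw [map_inv₀]
  exact inv_lt_one_of_one_lt₀ hx

/-- The functions whose pole at the place `P` is bounded by `γ`. -/
noncomputable def ball (P : FFPlace k F) (γ : P.asSubring.ValueGroup) : Submodule k F where
  carrier := {f | P.val f ≤ γ}
  zero_mem' := by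
    change P.val 0 ≤ γ
    simp
  add_mem' := fun ha hb ↦ P.val.map_add_le ha hb
  smul_mem' := fun c f hf ↦ (P.val_smul_le c f).trans hf

@[simp]
theorem mem_ball {P : FFPlace k F} {γ : P.asSubring.ValueGroup} {f : F} :
    f ∈ P.ball γ ↔ P.val f ≤ γ := Iff.rfl

end FFPlace

variable (k) in
/-- The Riemann-Roch space of `a` times the polar divisor of `x`. -/
noncomputable def rrSpace (x : F) (a : ℕ) : Submodule k F :=
  ⨅ P : FFPlace k F, P.ball (max 1 (P.val x) ^ a)

theorem mem_rrSpace {x : F} {a : ℕ} {f : F} :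
    f ∈ rrSpace k x a ↔ ∀ P : FFPlace k F, P.val f ≤ max 1 (P.val x) ^ a := by
  simp [rrSpace]

theorem finrank_le_add_finrank_of_forall_val_aeval_mul_le
    (hF : ∀ t : F, Transcendental k t → Algebra.IsAlgebraic k⟮t⟯ F)
    {t : F} (ht : Transcendental k t) [FiniteDimensional k⟮t⟯ F] {p : k[X]} (hp : p ≠ 0)
    {U : Type*} [AddCommGroup U] [Module k U] [FiniteDimensional k U]
    (T : Finset (FFPlace k F)) (hT : ∀ P ∈ T, P.val t ≤ 1) (ψ : U →ₗ[k] FFPlace k F → F)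
    (hψ : ∀ u, ∀ P ∈ T, P.val (aeval t p * ψ u P) ≤ 1) (N : Submodule k U)
    (hN : ∀ u, (∀ P ∈ T, P.val (ψ u P) ≤ 1) → u ∈ N) :
    Module.finrank k U ≤ Module.finrank k⟮t⟯ F * p.natDegree + Module.finrank k N := by
  let b := Module.finBasis k U
  choose f hf using fun i ↦ FFPlace.exists_forall_val_sub_le_one hF T (ψ (b i))
  let ψ' : U →ₗ[k] F := b.constr k f
  have hψ' : ∀ u, ∀ P ∈ T, P.val (ψ' u - ψ u P) ≤ 1 := by
    intro u P hP
    let δ : U →ₗ[k] F := ψ' - LinearMap.proj P ∘ₗ ψ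
    change δ u ∈ P.ball 1
    rw [← b.sum_repr u, map_sum]
    refine Submodule.sum_mem _ fun i _ ↦ ?_
    rw [map_smul]
    refine Submodule.smul_mem _ _ ?_
    have : δ (b i) = f i - ψ (b i) P := by simp [δ, ψ']
    rw [this]
    exact hf i P hP
  have hp0 : aeval t p ≠ 0 := fun h ↦ hp (transcendental_iff.mp ht p h)
  let M : Submodule k F := ⨅ P ∈ T, P.ball 1
  have hM {f : F} : f ∈ M ↔ ∀ P ∈ T, P.val f ≤ 1 := by simp [M]
  refine finrank_le_finrank_mul_natDegree_add ht hp
    ((LinearMap.mulLeft k (aeval t p)) ∘ₗ ψ') M ?_ ?_ N ?_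
  · intro g hg
    rw [hM] at hg ⊢
    intro P hP
    rw [map_mul]
    exact mul_le_one' (hT P hP) (hg P hP)
  · intro u
    rw [hM]
    intro P hP
    have : aeval t p * ψ' u = aeval t p * (ψ' u - ψ u P) + aeval t p * ψ u P := by ring
    change P.val (aeval t p * ψ' u) ≤ 1
    rw [this]
    refine P.val.map_add_le ?_ (hψ u P hP)
    rw [map_mul]
    exact mul_le_one' (P.val_aeval_le_one (hT P hP) p) (hψ' u P hP)
  · intro u g hg hug
    have hug : aeval t p * ψ' u = aeval t p * g := hug
    have hug := mul_left_cancel₀ hp0 hug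
    refine hN u fun P hP ↦ ?_
    have : ψ u P = g - (ψ' u - ψ u P) := by rw [hug]; ring
    rw [this]
    exact P.val.map_sub_le (hM.mp hg P hP) (hψ' u P hP)

theorem Submodule.exists_finset_iInf_le {K U ι : Type*} [Field K] [AddCommGroup U] [Module K U]
    [FiniteDimensional K U] (D : ι → Submodule K U) :
    ∃ T : Finset ι, ∀ i, ⨅ j ∈ T, D j ≤ D i := by
  classical
  obtain ⟨_, ⟨T, rfl⟩, hT⟩ := IsArtinian.set_has_minimal
    (Set.range fun T : Finset ι ↦ ⨅ j ∈ T, D j) (Set.range_nonempty _)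
  refine ⟨T, fun i ↦ ?_⟩
  have h := hT _ ⟨insert i T, rfl⟩
  simp only [Finset.iInf_insert] at h
  by_contra hi
  exact h (lt_of_le_of_ne inf_le_right fun h' ↦ hi (h' ▸ inf_le_left))

theorem exists_forall_val_aeval_mul_le_one (x : F) [Algebra.IsAlgebraic k⟮x⟯ F] (S : Finset F) :
    ∃ p : k[X], aeval x p ≠ 0 ∧
      ∀ f ∈ S, ∀ P : FFPlace k F, P.val x ≤ 1 → P.val (aeval x p * f) ≤ 1 := by
  classical
  induction S using Finset.induction_on with
  | empty => exact ⟨1, by simp⟩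
  | insert f S hf ih =>
    obtain ⟨p, hp0, hp⟩ := ih
    obtain ⟨q, hq0, hq⟩ := FFPlace.exists_val_aeval_mul_le_one (k := k) x f
    refine ⟨q * p, by simp [hp0, hq0], ?_⟩
    simp only [Finset.mem_insert, forall_eq_or_imp]
    refine ⟨fun P hP ↦ ?_, fun g hg P hP ↦ ?_⟩
    · rw [map_mul (aeval x), mul_comm (aeval x q), mul_assoc, map_mul]
      exact mul_le_one' (P.val_aeval_le_one hP p) (hq P hP)
    · rw [map_mul (aeval x), mul_assoc, map_mul]
      exact mul_le_one' (P.val_aeval_le_one hP q) (hp g hg P hP)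

theorem exists_forall_val_aeval_mul_and_val_inv_pow_mul_le_one
    (hF : ∀ t : F, Transcendental k t → Algebra.IsAlgebraic k⟮t⟯ F)
    {x : F} (hx : Transcendental k x) {ι : Type*} [Fintype ι] (α : ι → adeleSubmodule k F) :
    ∃ (p : k[X]) (c : ℕ), p ≠ 0 ∧ ∀ i, ∀ P : FFPlace k F,
      (P.val x ≤ 1 → P.val (aeval x p * (α i).1 P) ≤ 1) ∧
      (1 < P.val x → P.val (x⁻¹ ^ c * (α i).1 P) ≤ 1) := by
  classical
  have := hF x hx
  let B : Finset (ι × FFPlace k F) :=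
    (Finset.univ : Finset ι).sigma (fun i ↦ (α i).2.toFinset) |>.image fun z ↦ (z.1, z.2)
  have hB : ∀ i P, (i, P) ∉ B → P.val ((α i).1 P) ≤ 1 := by
    intro i P h
    by_contra h'
    refine h (Finset.mem_image.mpr ⟨⟨i, P⟩, ?_, rfl⟩)
    rw [Finset.mem_sigma]
    refine ⟨Finset.mem_univ _, (Set.Finite.mem_toFinset _).mpr ?_⟩
    exact fun hmem ↦ h' ((P.val_le_one_iff _).mpr hmem)
  obtain ⟨p, hp0, hp⟩ := exists_forall_val_aeval_mul_le_one (k := k) x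
    (B.image fun z ↦ (α z.1).1 z.2)
  have hN (z : ι × FFPlace k F) : ∃ N₀, 1 < z.2.val x →
      ∀ N ≥ N₀, z.2.val (x⁻¹ ^ N * (α z.1).1 z.2) < 1 := by
    by_cases hz : 1 < z.2.val x
    · have hz' : z.2.val x⁻¹ < 1 := by rw [map_inv₀]; exact inv_lt_one_of_one_lt₀ hz
      obtain ⟨N, hN⟩ := FFPlace.exists_forall_val_pow_mul_lt_one hF z.2 hz' ((α z.1).1 z.2)
      exact ⟨N, fun _ ↦ hN⟩
    · exact ⟨0, fun h ↦ (hz h).elim⟩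
  choose N hN using hN
  refine ⟨p, B.sup N, by rintro rfl; simp at hp0, fun i P ↦ ?_⟩
  by_cases hiP : (i, P) ∈ B
  · exact ⟨hp _ (Finset.mem_image.mpr ⟨_, hiP, rfl⟩) P,
      fun hP ↦ (hN (i, P) hP _ (Finset.le_sup hiP)).le⟩
  · refine ⟨fun hP ↦ ?_, fun hP ↦ ?_⟩
    · rw [map_mul]
      exact mul_le_one' (P.val_aeval_le_one hP p) (hB i P hiP)
    · rw [map_mul, map_pow, map_inv₀]
      exact mul_le_one' (pow_le_one' (inv_lt_one_of_one_lt₀ hP).le _) (hB i P hiP)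

end RiemannRoch

section Genus

variable {k F}

theorem adjoin_simple_inv (x : F) : k⟮x⁻¹⟯ = k⟮x⟯ := by
  refine le_antisymm ?_ ?_
  · exact adjoin_simple_le_iff.mpr (inv_mem (mem_adjoin_simple_self k x))
  · refine adjoin_simple_le_iff.mpr ?_
    have := inv_mem (mem_adjoin_simple_self k x⁻¹)
    rwa [inv_inv] at this

theorem transcendental_inv {x : F} (hx : Transcendental k x) : Transcendental k x⁻¹ :=
  fun h ↦ hx (by simpa using h.inv)

theorem finrank_le_add_add_of_val_mul_le_one
    (hF : ∀ t : F, Transcendental k t → Algebra.IsAlgebraic k⟮t⟯ F)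
    {x : F} (hx : Transcendental k x) [FiniteDimensional k⟮x⟯ F] {p : k[X]} (hp : p ≠ 0) (c : ℕ)
    {U : Type*} [AddCommGroup U] [Module k U] [FiniteDimensional k U]
    (ψ : U →ₗ[k] FFPlace k F → F)
    (hψ : ∀ u, ∀ P : FFPlace k F, P.val x ≤ 1 → P.val (aeval x p * ψ u P) ≤ 1)
    (hψ' : ∀ u, ∀ P : FFPlace k F, 1 < P.val x → P.val (x⁻¹ ^ c * ψ u P) ≤ 1) :
    Module.finrank k U ≤ Module.finrank k⟮x⟯ F * (p.natDegree + c) +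
      Module.finrank k ((integralAdeles k F).comap ψ) := by
  classical
  obtain ⟨T, hT⟩ := Submodule.exists_finset_iInf_le
    fun P : FFPlace k F ↦ (P.ball 1).comap (LinearMap.proj P ∘ₗ ψ)
  let N₁ : Submodule k U :=
    ⨅ P ∈ T.filter fun P ↦ P.val x ≤ 1, (P.ball 1).comap (LinearMap.proj P ∘ₗ ψ)
  have h₁ := finrank_le_add_finrank_of_forall_val_aeval_mul_le hF hx hp
    (T.filter fun P ↦ P.val x ≤ 1) (by simp) ψ (fun u P hP ↦ hψ u P (by simp_all)) N₁
    (fun u hu ↦ by simpa [N₁] using hu)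
  have hfd : FiniteDimensional k⟮x⁻¹⟯ F := by rw [adjoin_simple_inv]; infer_instance
  have h₂ := finrank_le_add_finrank_of_forall_val_aeval_mul_le hF (transcendental_inv hx)
    (p := X ^ c) (pow_ne_zero _ X_ne_zero)
    (T.filter fun P ↦ 1 < P.val x) (fun P hP ↦ by
      rw [map_inv₀]
      exact (inv_lt_one_of_one_lt₀ (Finset.mem_filter.mp hP).2).le) (ψ ∘ₗ N₁.subtype)
    (fun u P hP ↦ by
      rw [map_pow, aeval_X]
      exact hψ' u P (Finset.mem_filter.mp hP).2)
    (((integralAdeles k F).comap ψ).comap N₁.subtype) (fun u hu P ↦ by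
      rw [← P.val_le_one_iff]
      refine hT P (x := (u : U)) ?_
      simp only [Submodule.mem_iInf]
      intro Q hQ
      by_cases hQx : Q.val x ≤ 1
      · have := u.2
        simp only [N₁, Submodule.mem_iInf] at this
        exact this Q (Finset.mem_filter.mpr ⟨hQ, hQx⟩)
      · exact hu Q (Finset.mem_filter.mpr ⟨hQ, not_le.mp hQx⟩))
  have h₃ : Module.finrank k (((integralAdeles k F).comap ψ).comap N₁.subtype) ≤
      Module.finrank k ((integralAdeles k F).comap ψ) := by
    refine LinearMap.finrank_le_finrank_of_injective
      (f := (N₁.subtype.restrict (p := ((integralAdeles k F).comap ψ).comap N₁.subtype)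
        (q := (integralAdeles k F).comap ψ) fun u hu ↦ hu)) ?_
    intro u v huv
    exact Subtype.ext (Subtype.ext (congrArg (fun z ↦ z.1) huv))
  rw [natDegree_X_pow, adjoin_simple_inv] at h₂
  linarith

theorem genus_le
    (hF : ∀ t : F, Transcendental k t → Algebra.IsAlgebraic k⟮t⟯ F)
    (hk : ∀ f : F, IsAlgebraic k f → f ∈ (algebraMap k F).range)
    {x : F} (hx : Transcendental k x) [FiniteDimensional k⟮x⟯ F] {G : ℕ}
    (hRR : ∀ a : ℕ, ∃ V : Submodule k F, FiniteDimensional k V ∧ V ≤ rrSpace k x a ∧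
      a * Module.finrank k⟮x⟯ F + 1 ≤ Module.finrank k V + G) :
    genus k F ≤ G := by
  by_contra! hG
  obtain ⟨w, hw⟩ := exists_linearIndependent_of_le_finrank (Nat.succ_le_of_lt hG)
  choose α hα using fun i ↦ Submodule.mkQ_surjective _ (w i)
  obtain ⟨p, c, hp, hpc⟩ := exists_forall_val_aeval_mul_and_val_inv_pow_mul_le_one hF hx α
  have hp0 : aeval x p ≠ 0 := fun h ↦ hp (transcendental_iff.mp hx p h)
  obtain ⟨V, hVfd, hV, hVG⟩ := hRR (c + p.natDegree)
  let ψ₁ : (Fin (G + 1) → k) →ₗ[k] FFPlace k F → F :=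
    (adeleSubmodule k F).subtype ∘ₗ Fintype.linearCombination k α
  let ψ₂ : V →ₗ[k] FFPlace k F → F :=
    (LinearMap.pi fun _ ↦ LinearMap.mulLeft k (aeval x p)⁻¹) ∘ₗ V.subtype
  have hψ₁ (u P) : ψ₁ u P = ∑ i, u i • (α i).1 P := by
    simp [ψ₁, Fintype.linearCombination_apply]
  have hψ₁' (z : F) (P : FFPlace k F)
      (h : ∀ i, P.val (z * (α i).1 P) ≤ 1) (u) : P.val (z * ψ₁ u P) ≤ 1 := by
    rw [hψ₁, Finset.mul_sum]
    change _ ∈ P.ball 1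
    refine Submodule.sum_mem _ fun i _ ↦ ?_
    rw [mul_smul_comm]
    exact Submodule.smul_mem _ _ (h i)
  have hψ₂ (v P) : ψ₂ v P = (aeval x p)⁻¹ * v := rfl
  have key := finrank_le_add_add_of_val_mul_le_one hF hx hp c (ψ₁.coprod ψ₂) ?_ ?_
  · have hN : Module.finrank k ((integralAdeles k F).comap (ψ₁.coprod ψ₂)) ≤ 1 := by
      have hmem : ∀ u ∈ (integralAdeles k F).comap (ψ₁.coprod ψ₂), u.1 = 0 := by
        rintro ⟨u, v⟩ huv
        have h : Fintype.linearCombination k w u = 0 := by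
          have : Fintype.linearCombination k w u =
              Submodule.mkQ _ (Fintype.linearCombination k α u) := by
            simp [Fintype.linearCombination_apply, hα]
          rw [this, Submodule.mkQ_apply, Submodule.Quotient.mk_eq_zero]
          change ψ₁ u ∈ integralAdeles k F ⊔ principalAdeles k F
          have h' : ψ₁ u = (ψ₁.coprod ψ₂) (u, v) - ψ₂ v := by simp
          rw [h']
          exact sub_mem (Submodule.mem_sup_left huv) (Submodule.mem_sup_right ⟨_, rfl⟩)
        have := (Fintype.linearIndependent_iff.mp hw) u (by
          simpa [Fintype.linearCombination_apply] using h)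
        exact _root_.funext this
      let θ : (Fin (G + 1) → k) × V →ₗ[k] F :=
        LinearMap.mulLeft k (aeval x p)⁻¹ ∘ₗ V.subtype ∘ₗ LinearMap.snd k _ _
      have hθ : ∀ u ∈ (integralAdeles k F).comap (ψ₁.coprod ψ₂),
          θ u ∈ LinearMap.range (Algebra.linearMap k F) := by
        rintro ⟨u, v⟩ huv
        obtain rfl : u = 0 := hmem _ huv
        obtain ⟨a, ha⟩ := hk _ (FFPlace.isAlgebraic_of_forall_val_le_one
          (f := θ (0, v)) fun P ↦ by
            have := huv P
            rw [← P.val_le_one_iff] at this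
            rw [LinearMap.coprod_apply, map_zero, zero_add] at this
            exact this)
        exact ⟨a, ha⟩
      refine (LinearMap.finrank_le_finrank_of_injective (f := θ.restrict hθ) ?_).trans ?_
      · rintro ⟨⟨u, v⟩, hu⟩ ⟨⟨u', v'⟩, hu'⟩ h
        have hv : (aeval x p)⁻¹ * (v : F) = (aeval x p)⁻¹ * v' := congrArg Subtype.val h
        obtain rfl : v = v' := Subtype.ext (mul_left_cancel₀ (inv_ne_zero hp0) hv)
        obtain rfl : u = 0 := hmem _ hu
        obtain rfl : u' = 0 := hmem _ hu'
        rfl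
      · exact (LinearMap.finrank_range_le _).trans (by simp)
    rw [Module.finrank_prod, Module.finrank_fin_fun] at key
    rw [mul_comm, add_comm c] at hVG
    omega
  · rintro ⟨u, v⟩ P hP
    rw [LinearMap.coprod_apply, Pi.add_apply, mul_add]
    refine P.val.map_add_le (hψ₁' _ P (fun i ↦ (hpc i P).1 hP) u) ?_
    rw [hψ₂, mul_inv_cancel_left₀ hp0]
    simpa [hP] using mem_rrSpace.mp (hV v.2) P
  · rintro ⟨u, v⟩ P hP
    rw [LinearMap.coprod_apply, Pi.add_apply, mul_add]
    refine P.val.map_add_le (hψ₁' _ P (fun i ↦ (hpc i P).2 hP) u) ?_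
    have := mem_rrSpace.mp (hV v.2) P
    rw [max_eq_right hP.le] at this
    rw [hψ₂, map_mul, map_mul, map_pow, map_inv₀, map_inv₀, P.val_aeval_eq_pow hP hp]
    have h0 : 0 < P.val x := zero_lt_one.trans hP
    rw [inv_pow, ← mul_assoc, ← mul_inv, ← pow_add]
    exact inv_mul_le_one_of_le₀ this zero_le

end Genus

section Fields

variable {k F}

theorem isAlgebraic_adjoin_simple_of_transcendental (hF : IsFunctionField k F) {t : F}
    (ht : Transcendental k t) : Algebra.IsAlgebraic k⟮t⟯ F := by
  obtain ⟨x, hx, hfd⟩ := hF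
  open algebraAdjoinAdjoin in
  have : Algebra.IsAlgebraic (Algebra.adjoin k {x}) F :=
    Algebra.IsAlgebraic.trans _ k⟮x⟯ _
  have htr : Algebra.trdeg k F ≤ 1 := by
    simpa using Algebra.IsAlgebraic.trdeg_le_cardinalMk k ({x} : Set F)
  have hb : IsTranscendenceBasis k (fun _ : Unit ↦ t) :=
    AlgebraicIndependent.isTranscendenceBasis_of_lift_trdeg_le_of_finite
      ((algebraicIndependent_unique_type_iff).mpr ht) (by simpa using htr)
  have := hb.isAlgebraic_field
  rwa [Set.range_const] at this

theorem finrank_adjoin_simple_mul_finrank (E : IntermediateField k F) (y : E) :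
    Module.finrank k⟮y⟯ E * Module.finrank E F = Module.finrank k⟮(y : F)⟯ F := by
  have h : lift k⟮y⟯ = k⟮(y : F)⟯ := lift_adjoin_simple _ _ _
  have hle : k⟮(y : F)⟯ ≤ E := adjoin_simple_le_iff.mpr y.2
  let _ : Algebra k⟮(y : F)⟯ E := (inclusion hle).toAlgebra
  have : IsScalarTower k⟮(y : F)⟯ E F := .of_algebraMap_eq fun _ ↦ rfl
  rw [← Module.finrank_mul_finrank k⟮(y : F)⟯ E F]
  congr 1
  exact Algebra.finrank_eq_of_equiv_equiv
    ((liftAlgEquiv k⟮y⟯).trans (equivOfEq h)).toRingEquiv (RingEquiv.refl E) rfl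

theorem mem_range_algebraMap_of_isAlgebraic
    [IsDomain (TensorProduct k (AlgebraicClosure k) F)] {f : F} (hf : IsAlgebraic k f) :
    f ∈ (algebraMap k F).range := by
  let A := TensorProduct k (AlgebraicClosure k) F
  let ι : F →ₐ[k] A := Algebra.TensorProduct.includeRight
  have hs : ((minpoly k f).map (algebraMap k (AlgebraicClosure k))).Splits :=
    IsAlgClosed.splits _
  have hprod : aeval (ι f) (minpoly k f) = 0 := by
    rw [aeval_algHom_apply, minpoly.aeval, map_zero]
  have : ∃ c : AlgebraicClosure k, ι f = algebraMap (AlgebraicClosure k) A c := by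
    rw [← aeval_map_algebraMap (AlgebraicClosure k), hs.eq_prod_roots_of_monic
      ((minpoly.monic hf.isIntegral).map _), map_multiset_prod, Multiset.prod_eq_zero_iff,
      Multiset.map_map] at hprod
    obtain ⟨c, -, hc⟩ := Multiset.mem_map.mp hprod
    rw [Function.comp_apply, map_sub, aeval_X, aeval_C] at hc
    exact ⟨_, sub_eq_zero.mp hc⟩
  obtain ⟨c, hc⟩ := this
  by_contra hfk
  have hf1 : f ∉ Submodule.span k {(1 : F)} := by
    rw [Submodule.mem_span_singleton]
    rintro ⟨a, ha⟩
    exact hfk ⟨a, by rw [← ha, Algebra.smul_def, mul_one]⟩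
  obtain ⟨φ, hφf, hφ1⟩ := Submodule.exists_dual_map_eq_bot_of_notMem hf1 inferInstance
  have hφ1 : φ 1 = 0 := by
    rw [Submodule.map_span, Set.image_singleton, Submodule.span_singleton_eq_bot] at hφ1
    exact hφ1
  have hc : (1 : AlgebraicClosure k) ⊗ₜ[k] f = c ⊗ₜ[k] (1 : F) := hc
  have h := congrArg (TensorProduct.rid k _ ∘ LinearMap.lTensor (AlgebraicClosure k) φ) hc
  simp [hφ1, hφf] at h

end Fields

section LowerBound

variable {k F}

theorem mul_finrank_le_add_finrank_of_le_rrSpace {x y : F} (hy : Transcendental k y)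
    {E₁ E₂ : IntermediateField k F} (hE : E₁ ≤ E₂) (hyE : y ∈ E₂) {n : ℕ}
    (hn : LinearIndependent E₁ fun i : Fin (n + 1) ↦ y ^ (i : ℕ))
    [FiniteDimensional k⟮(⟨y, hyE⟩ : E₂)⟯ E₂] {a : ℕ} {V₁ : Submodule k F}
    [FiniteDimensional k V₁] (hV₁ : V₁ ≤ rrSpace k x a) (hV₁E : ∀ f ∈ V₁, f ∈ E₁) :
    ∃ V₂ : Submodule k F, FiniteDimensional k V₂ ∧ V₂ ≤ rrSpace k x a ∧ (∀ f ∈ V₂, f ∈ E₂) ∧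
      (n + 1) * Module.finrank k V₁ ≤
        Module.finrank k⟮(⟨y, hyE⟩ : E₂)⟯ E₂ * n + Module.finrank k V₂ := by
  set y' : E₂ := ⟨y, hyE⟩ with hy'
  have hy'tr : Transcendental k y' := fun h ↦ hy (h.algebraMap (A := F))
  have hy0 : y ≠ 0 := by rintro rfl; exact hy isAlgebraic_zero
  let ι : V₁ →ₗ[k] E₂ :=
    { toFun v := ⟨v, hE (hV₁E v v.2)⟩
      map_add' _ _ := rfl
      map_smul' _ _ := rfl }
  let σ : (Fin (n + 1) → V₁) →ₗ[k] E₂ :=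
    ∑ j : Fin (n + 1), LinearMap.mulLeft k (y' ^ (j : ℕ)) ∘ₗ ι ∘ₗ LinearMap.proj j
  let τ : (Fin (n + 1) → V₁) →ₗ[k] F := E₂.val.toLinearMap ∘ₗ σ
  have hτ (u) : τ u = ∑ j : Fin (n + 1), y ^ (j : ℕ) * (u j : F) := by
    simp [τ, σ, ι, hy']
  have hτinj : Function.Injective τ := by
    rw [← LinearMap.ker_eq_bot, LinearMap.ker_eq_bot']
    intro u hu
    have := Fintype.linearIndependent_iff.mp hn (fun j ↦ ⟨u j, hV₁E _ (u j).2⟩) (by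
      rw [← hu, hτ]
      exact Finset.sum_congr rfl fun j _ ↦ mul_comm _ _)
    exact _root_.funext fun j ↦ Subtype.ext (congrArg (fun z : E₁ ↦ (z : F)) (this j))
  let M : Submodule k E₂ :=
    (⨅ (P : FFPlace k F) (_ : 1 < P.val y), P.ball (max 1 (P.val x) ^ a)).comap
      E₂.val.toLinearMap
  have hM {f : E₂} : f ∈ M ↔
      ∀ P : FFPlace k F, 1 < P.val y → P.val (f : F) ≤ max 1 (P.val x) ^ a := by
    simp [M]
  let N : Submodule k (Fin (n + 1) → V₁) := (rrSpace k x a).comap τ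
  have hfd : FiniteDimensional k⟮y'⁻¹⟯ E₂ := by rw [adjoin_simple_inv]; infer_instance
  have key := finrank_le_finrank_mul_natDegree_add (transcendental_inv hy'tr) (p := X ^ n)
    (pow_ne_zero _ X_ne_zero) (LinearMap.mulLeft k (y'⁻¹ ^ n) ∘ₗ σ) M ?_ ?_ N ?_
  · refine ⟨N.map τ, inferInstance, Submodule.map_le_iff_le_comap.mpr le_rfl, ?_, ?_⟩
    · rintro _ ⟨u, -, rfl⟩
      exact (σ u).2
    · rw [← (Submodule.equivMapOfInjective τ hτinj N).finrank_eq]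
      rw [adjoin_simple_inv, natDegree_X_pow] at key
      simpa [Module.finrank_pi_fintype] using key
  · intro f hf
    rw [hM] at hf ⊢
    intro P hP
    change P.val (y⁻¹ * f) ≤ _
    rw [map_mul, map_inv₀]
    exact (mul_le_of_le_one_left' (inv_lt_one_of_one_lt₀ hP).le).trans (hf P hP)
  · intro u
    rw [hM]
    intro P hP
    change P.val (y⁻¹ ^ n * τ u) ≤ _
    rw [hτ, Finset.mul_sum]
    change _ ∈ P.ball _
    refine Submodule.sum_mem _ fun j _ ↦ ?_
    rw [FFPlace.mem_ball, ← mul_assoc, map_mul]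
    refine (mul_le_of_le_one_left' ?_).trans (mem_rrSpace.mp (hV₁ (u j).2) P)
    rw [map_mul, map_pow, map_pow, map_inv₀, inv_pow]
    exact inv_mul_le_one_of_le₀ (pow_le_pow_right₀ hP.le (Fin.is_le j)) zero_le
  · intro u f hf huf
    have hσ : σ u = f := by
      refine mul_left_cancel₀ (pow_ne_zero n (inv_ne_zero (a := y') ?_)) (by simpa using huf)
      exact fun h ↦ hy0 (congrArg Subtype.val h)
    change τ u ∈ rrSpace k x a
    rw [mem_rrSpace]
    intro P
    by_cases hP : 1 < P.val y
    · rw [← hσ] at hf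
      exact hM.mp hf P hP
    · rw [hτ]
      change _ ∈ P.ball _
      refine Submodule.sum_mem _ fun j _ ↦ ?_
      rw [FFPlace.mem_ball, map_mul, map_pow]
      exact (mul_le_of_le_one_left' (pow_le_one' (not_lt.mp hP) _)).trans
        (mem_rrSpace.mp (hV₁ (u j).2) P)

theorem exists_le_rrSpace_adjoin {d : ℕ} (hd : 0 < d) {x : F} (S : Finset F)
    (hx : Transcendental k x ∧ Module.finrank k⟮x⟯ F = d)
    (hS : ∀ f ∈ S, Transcendental k f ∧ Module.finrank k⟮f⟯ F = d) :
    ∃ m > 0, m * Module.finrank (adjoin k (insert x S : Set F)) F = d ∧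
      ∀ a : ℕ, ∃ V : Submodule k F, FiniteDimensional k V ∧ V ≤ rrSpace k x a ∧
        (∀ f ∈ V, f ∈ adjoin k (insert x S : Set F)) ∧
        a * m + 1 ≤ Module.finrank k V + (m - 1) ^ 2 := by
  classical
  induction S using Finset.induction_on with
  | empty =>
    refine ⟨1, one_pos, by rw [Finset.coe_empty, insert_empty_eq, one_mul, hx.2], fun a ↦ ?_⟩
    have hli : LinearIndependent k fun i : Fin (a + 1) ↦ x ^ (i : ℕ) := by
      have := (basisMonomials k).linearIndependent.map' (aeval x).toLinearMap
        (LinearMap.ker_eq_bot.mpr (transcendental_iff_injective.mp hx.1))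
      have := this.comp _ (Fin.val_injective (n := a + 1))
      simpa [Function.comp_def] using this
    refine ⟨Submodule.span k (Set.range fun i : Fin (a + 1) ↦ x ^ (i : ℕ)),
      FiniteDimensional.span_of_finite _ (Set.finite_range _), ?_, ?_, ?_⟩
    · rw [Submodule.span_le]
      rintro _ ⟨i, rfl⟩
      refine mem_rrSpace.mpr fun P ↦ ?_
      rw [map_pow]
      exact (pow_le_pow_left₀ zero_le (le_max_right _ _) _).trans
        (pow_le_pow_right₀ (le_max_left _ _) (Fin.is_le i))
    · intro f hf
      refine (Submodule.span_le (p := (adjoin k _).toSubmodule)).mpr ?_ hf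
      rintro _ ⟨i, rfl⟩
      exact pow_mem (subset_adjoin _ _ (by simp)) _
    · rw [finrank_span_eq_card hli]
      simp
  | insert y S hyS ih =>
    simp only [Finset.mem_insert, forall_eq_or_imp] at hS
    obtain ⟨m, hm, hmd, hV⟩ := ih hS.2
    set E₁ := adjoin k (insert x S : Set F) with hE₁
    set E₂ := adjoin k (insert x (insert y S : Finset F) : Set F) with hE₂
    have hE : (E₁⟮y⟯).restrictScalars k = E₂ := by
      rw [hE₁, hE₂, adjoin_adjoin_left]
      congr 1
      ext; simp; tauto
    have hle : E₁ ≤ E₂ := adjoin.mono _ _ _ (by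
      intro; simp; tauto)
    have hyE : y ∈ E₂ := subset_adjoin _ _ (by simp)
    have : FiniteDimensional E₁ F :=
      FiniteDimensional.of_finrank_pos (Nat.pos_of_mul_pos_left (hmd ▸ hd))
    have hyint : IsIntegral E₁ y := Algebra.IsIntegral.isIntegral y
    have h₁ := finrank_adjoin_simple_mul_finrank E₂ ⟨y, hyE⟩
    rw [hS.1.2] at h₁
    have : FiniteDimensional k⟮(⟨y, hyE⟩ : E₂)⟯ E₂ :=
      FiniteDimensional.of_finrank_pos (Nat.pos_of_mul_pos_right (h₁ ▸ hd))
    have h₂ : (minpoly E₁ y).natDegree * Module.finrank E₂ F = Module.finrank E₁ F := by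
      rw [← adjoin.finrank hyint, ← hE]
      exact Module.finrank_mul_finrank E₁ E₁⟮y⟯ F
    obtain ⟨n, hn⟩ := Nat.exists_eq_add_of_lt (minpoly.natDegree_pos hyint)
    rw [zero_add] at hn
    rw [hn] at h₂
    have h₃ : Module.finrank k⟮(⟨y, hyE⟩ : E₂)⟯ E₂ = m * (n + 1) := by
      refine Nat.eq_of_mul_eq_mul_right (Nat.pos_of_mul_pos_left (h₁ ▸ hd)) ?_
      rw [h₁, mul_assoc, h₂, hmd]
    refine ⟨m * (n + 1), by positivity, by rw [mul_assoc, h₂, hmd], fun a ↦ ?_⟩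
    obtain ⟨V₁, _, hV₁, hV₁E, hV₁a⟩ := hV a
    obtain ⟨V₂, hfd, hV₂, hV₂E, hle⟩ := mul_finrank_le_add_finrank_of_le_rrSpace (n := n) hS.1.1
      hle hyE (hn ▸ linearIndependent_pow y) hV₁ hV₁E
    refine ⟨V₂, hfd, hV₂, hV₂E, ?_⟩
    rw [h₃] at hle
    obtain ⟨p, rfl⟩ := Nat.exists_eq_add_of_lt hm
    simp only [zero_add, Nat.add_sub_cancel] at *
    have : (p + 1) * (n + 1) - 1 = p * n + p + n := by
      rw [show (p + 1) * (n + 1) = p * n + p + n + 1 by ring, Nat.add_sub_cancel]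
    rw [this]
    nlinarith [Nat.zero_le (p ^ 2 * n ^ 2), Nat.zero_le (p ^ 2 * n), Nat.zero_le (p * n ^ 2),
      Nat.zero_le (p * n), Nat.mul_le_mul_left (n + 1) hV₁a]

end LowerBound

end

/-- let `X` be a geometrically integral curve over a perfect field `k`, with
function field `k(X) = F`, and let `d` be a positive integer.  A subfield of `F` generated
over `k` by one or more elements each of degree `d` (an element `f` has degree `d` when
`[F : k(f)] = d`) is `d`-controlled. -/
theorem isDControlled_adjoin_of_forall_degree_eq
    (k F : Type*) [Field k] [Field F] [Algebra k F] [PerfectField k]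
    (hF : IsFunctionField k F)
    [IsDomain (TensorProduct k (AlgebraicClosure k) F)]
    (d : ℕ) (hd : 0 < d)
    (s : Finset F) (hs : s.Nonempty)
    (hdeg : ∀ f ∈ s, Transcendental k f ∧
      Module.finrank (IntermediateField.adjoin k {f}) F = d) :
    IsDControlled k F d (IntermediateField.adjoin k (s : Set F)) := by
  classical
  set E := adjoin k (s : Set F) with hE
  obtain ⟨x, hxs⟩ := hs
  have hsE : ∀ f ∈ s, f ∈ E := fun f hf ↦ subset_adjoin _ _ hf
  let x' : E := ⟨x, hsE x hxs⟩
  let e := Module.finrank k⟮x'⟯ E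
  have he : e * Module.finrank E F = d := by
    rw [finrank_adjoin_simple_mul_finrank, (hdeg x hxs).2]
  have he0 : 0 < e := Nat.pos_of_mul_pos_right (he ▸ hd)
  have hEF : 0 < Module.finrank E F := Nat.pos_of_mul_pos_left (he ▸ hd)
  have hdeg' : ∀ f : E, (f : F) ∈ s → Transcendental k f ∧ Module.finrank k⟮f⟯ E = e := by
    intro f hf
    refine ⟨fun h ↦ (hdeg f hf).1 (h.algebraMap (A := F)), ?_⟩
    refine Nat.eq_of_mul_eq_mul_right hEF ?_
    rw [finrank_adjoin_simple_mul_finrank, (hdeg f hf).2, he]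
  have hx' := hdeg' x' hxs
  have : FiniteDimensional k⟮x'⟯ E := FiniteDimensional.of_finrank_pos he0
  let s' : Finset E := s.preimage (algebraMap E F) (algebraMap E F).injective.injOn
  obtain ⟨m, -, hm, hV⟩ := exists_le_rrSpace_adjoin he0 s' hx'
    fun f hf ↦ hdeg' f (by simpa [s'] using hf)
  have htop : adjoin k (insert x' s' : Set E) = ⊤ := by
    apply lift_injective
    rw [lift_adjoin, lift_top]
    refine le_antisymm ?_ ?_
    · rw [adjoin_le_iff]
      rintro _ ⟨f, -, rfl⟩
      exact f.2
    · refine adjoin.mono _ _ _ fun f hf ↦ ⟨⟨f, hsE f hf⟩, Or.inr ?_, rfl⟩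
      simpa [s'] using hf
  rw [htop, IntermediateField.finrank_top, mul_one] at hm
  subst hm
  refine ⟨e, he0, he, genus_le (fun t ↦ isAlgebraic_adjoin_simple_of_transcendental
    ⟨x', hx'.1, inferInstance⟩) ?_ hx'.1 fun a ↦ ?_⟩
  · intro f hf
    obtain ⟨c, hc⟩ := mem_range_algebraMap_of_isAlgebraic (hf.algebraMap (A := F))
    exact ⟨c, Subtype.ext hc⟩
  · obtain ⟨V, hfd, hVx, -, hVa⟩ := hV a
    exact ⟨V, hfd, hVx, by rwa [hx'.2]⟩
end

section
/- (Tower theorem) Let X be a geometrically integral curve over a perfect field k, let L ⊇ k be an algebraic field extension, and let d = γ_L(X) be the L-gonality of X. Then k(X) has a d-controlled subfield; that is, there exists a subfield F of k(X) containing k and a positive integer e such that [k(X) : F] = d/e and the genus of F is at most (e − 1)². -/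
open IntermediateField

variable (k F : Type*) [Field k] [Field F] [Algebra k F]

open Polynomial

/-- Any more than `N` elements of `F` satisfy a nontrivial relation with coefficients in `K[x]`. -/
def HasPolyRankBound (K : Type*) {F : Type*} [Field K] [Field F] [Algebra K F] (x : F) (N : ℕ) :
    Prop :=
  ∀ ⦃n : ℕ⦄, N < n → ∀ v : Fin n → F, ∃ c : Fin n → K[X], c ≠ 0 ∧ ∑ i, aeval x (c i) * v i = 0

theorem exists_eq_pow_mul_not_dvd {A ι : Type*} [CommRing A] [IsDomain A] [WfDvdMonoid A]
    {p : A} (hp : ¬ IsUnit p) {c : ι → A} (hc : c ≠ 0) :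
    ∃ (k : ℕ) (c' : ι → A), (∀ i, c i = p ^ k * c' i) ∧ ∃ i, ¬ p ∣ c' i := by
  classical
  obtain ⟨i, hi⟩ := Function.ne_iff.1 hc
  have hfin : FiniteMultiplicity p (c i) := FiniteMultiplicity.of_not_isUnit hp hi
  obtain ⟨m, hm⟩ := hfin
  have hex : ∃ k, ¬ ∀ j, p ^ k ∣ c j := ⟨m + 1, fun h => hm (h i)⟩
  have hmin := fun k => Nat.find_min (m := k) hex
  have hspec := Nat.find_spec hex
  obtain ⟨k, hk⟩ : ∃ k, Nat.find hex = k + 1 := by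
    refine Nat.exists_eq_succ_of_ne_zero fun h0 => ?_
    rw [h0] at hspec
    simp at hspec
  rw [hk] at hspec
  have hdvd : ∀ j, p ^ k ∣ c j := not_not.1 (hmin k (by omega))
  choose c' hc' using hdvd
  refine ⟨k, c', hc', ?_⟩
  push Not at hspec
  obtain ⟨j, hj⟩ := hspec
  refine ⟨j, fun ⟨a, ha⟩ => hj ⟨a, ?_⟩⟩
  rw [hc', ha, pow_succ, mul_assoc]

section Field

variable {K F : Type*} [Field K] [Field F] [Algebra K F]

theorem hasPolyRankBound_of_finrank {x : F} {N : ℕ}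
    [FiniteDimensional (IntermediateField.adjoin K {x}) F]
    (hN : Module.finrank (IntermediateField.adjoin K {x}) F = N) : HasPolyRankBound K x N := by
  intro n hn v
  have hdep : ¬ LinearIndependent (IntermediateField.adjoin K {x}) v := by
    intro h
    have := h.fintype_card_le_finrank
    simp at this
    omega
  obtain ⟨g, hg, i, hi⟩ := Fintype.not_linearIndependent_iff.1 hdep
  have key : ∀ j, ∃ r s : K[X], aeval x s ≠ 0 ∧ (g j : F) * aeval x s = aeval x r := by
    intro j
    obtain ⟨r, s, h⟩ := (IntermediateField.mem_adjoin_simple_iff K (g j : F)).1 (g j).2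
    by_cases hs : aeval x s = 0
    · refine ⟨0, 1, by simp, ?_⟩
      rw [h, hs]; simp
    · exact ⟨r, s, hs, by rw [h]; field_simp⟩
  choose r s hs hrs using key
  have hprod : ∀ j, (∏ l, aeval x (s l)) * (g j : F)
      = aeval x (r j * ∏ l ∈ Finset.univ.erase j, s l) := by
    intro j
    rw [← Finset.mul_prod_erase _ _ (Finset.mem_univ j), map_mul, map_prod, ← hrs]
    ring
  refine ⟨fun j => r j * ∏ l ∈ Finset.univ.erase j, s l, ?_, ?_⟩
  · intro h
    have h1 := hprod i
    rw [show r i * ∏ l ∈ Finset.univ.erase i, s l = 0 from congrFun h i, map_zero] at h1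
    have : (g i : F) = 0 := by
      refine (mul_eq_zero.1 h1).resolve_left ?_
      exact Finset.prod_ne_zero_iff.2 fun l _ => hs l
    exact hi (by exact_mod_cast this)
  · simp_rw [← hprod, mul_assoc, ← Finset.mul_sum]
    have : ∑ j, (g j : F) * v j = 0 := hg
    rw [this, mul_zero]

theorem finrank_le_add_of_mul_mem {t : F} (ht : t ≠ 0) {N : ℕ} (hN : HasPolyRankBound K t N)
    {V W V' : Submodule K F} (hWV : W ≤ V) [FiniteDimensional K W] (hVV' : V ≤ V')
    (hmul : ∀ y ∈ V', t * y ∈ V') (hVW : ∀ y ∈ V', t * y ∈ V → t * y ∈ W) :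
    FiniteDimensional K V ∧ Module.finrank K V ≤ Module.finrank K W + N := by
  classical
  set U : Submodule K V := W.submoduleOf V with hU
  have hrank : Module.rank K (V ⧸ U) ≤ N := by
    refine rank_le fun s hs => ?_
    by_contra hlt
    push Not at hlt
    let e := s.equivFin.symm
    have hli : LinearIndependent K (fun i : Fin s.card => ((e i : s) : V ⧸ U)) := hs.comp _ e.injective
    choose v hv using fun i : Fin s.card => Submodule.Quotient.mk_surjective U ((e i : s) : V ⧸ U)
    obtain ⟨c, hc, hsum⟩ := hN hlt fun i => (v i : F)
    obtain ⟨k, c', hcc', j, hj⟩ := exists_eq_pow_mul_not_dvd not_isUnit_X hc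
    have hsum' : ∑ i, aeval t (c' i) * (v i : F) = 0 := by
      have : t ^ k * ∑ i, aeval t (c' i) * (v i : F) = 0 := by
        rw [Finset.mul_sum, ← hsum]
        refine Finset.sum_congr rfl fun i _ => ?_
        rw [hcc' i, map_mul, map_pow, aeval_X, mul_assoc]
      exact (mul_eq_zero.1 this).resolve_left (pow_ne_zero _ ht)
    have hpoly : ∀ p : K[X], ∀ y ∈ V', aeval t p * y ∈ V' := by
      intro p
      induction p using Polynomial.induction_on' with
      | add p q hp hq => intro y hy; rw [map_add, add_mul]; exact add_mem (hp y hy) (hq y hy)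
      | monomial m a =>
        intro y hy
        rw [aeval_monomial, mul_assoc, ← Algebra.smul_def]
        refine V'.smul_mem _ ?_
        induction m with
        | zero => simpa
        | succ m ih => rw [pow_succ', mul_assoc]; exact hmul _ ih
    have hy : ∑ i, aeval t ((c' i).divX) * (v i : F) ∈ V' :=
      sum_mem fun i _ => hpoly _ _ (hVV' (v i).2)
    have heq : ∑ i, (c' i).coeff 0 • (v i : F)
        = t * -(∑ i, aeval t ((c' i).divX) * (v i : F)) := by
      rw [mul_neg, eq_neg_iff_add_eq_zero, ← hsum', Finset.mul_sum, ← Finset.sum_add_distrib]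
      refine Finset.sum_congr rfl fun i _ => ?_
      conv_rhs => rw [← X_mul_divX_add (c' i)]
      rw [map_add, map_mul, aeval_X, aeval_C, Algebra.smul_def]
      ring
    have hmemV : ∑ i, (c' i).coeff 0 • (v i : F) ∈ V :=
      sum_mem fun i _ => V.smul_mem _ (v i).2
    have hmemW : ∑ i, (c' i).coeff 0 • (v i : F) ∈ W := by
      rw [heq] at hmemV ⊢
      exact hVW _ (neg_mem hy) hmemV
    have hz : ∑ i, (c' i).coeff 0 • ((e i : s) : V ⧸ U) = 0 := by
      simp_rw [← hv]
      have : (Submodule.Quotient.mk (p := U) (∑ i, (c' i).coeff 0 • v i)) = 0 := by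
        rw [Submodule.Quotient.mk_eq_zero]
        change V.subtype _ ∈ W
        simpa using hmemW
      rw [← this]
      exact (map_sum U.mkQ _ _).symm
    exact hj (X_dvd_iff.2 (Fintype.linearIndependent_iff.1 hli _ hz j))
  have : FiniteDimensional K (V ⧸ U) := by
    rw [FiniteDimensional, ← Module.rank_lt_aleph0_iff]
    exact hrank.trans_lt (Cardinal.natCast_lt_aleph0)
  have eU : U ≃ₗ[K] W := Submodule.submoduleOfEquivOfLe hWV
  have : FiniteDimensional K U := Module.Finite.equiv eU.symm
  have hV : FiniteDimensional K V := Module.Finite.of_submodule_quotient U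
  refine ⟨hV, ?_⟩
  rw [← Submodule.finrank_quotient_add_finrank U, eU.finrank_eq, add_comm]
  have := Module.finrank_le_of_rank_le hrank
  omega

end Field

theorem HasPolyRankBound.of_tower {K F M : Type*} [Field K] [Field F] [Field M] [Algebra K F]
    [Algebra K M] [Algebra F M] [IsScalarTower K F M] [FiniteDimensional F M] {x : F} {e d : ℕ}
    (hd : e * Module.finrank F M = d) (h : HasPolyRankBound K (algebraMap F M x) d) :
    HasPolyRankBound K x e := by
  classical
  intro n hn v
  let b := Module.finBasis F M
  have hlt : d < n * Module.finrank F M := by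
    rw [← hd]
    exact Nat.mul_lt_mul_of_pos_right hn Module.finrank_pos
  let eq := (finProdFinEquiv (m := n) (n := Module.finrank F M))
  obtain ⟨c, hc, hsum⟩ := h hlt fun p => algebraMap F M (v (eq.symm p).1) * b (eq.symm p).2
  have hsum2 : ∑ j, (∑ i, aeval x (c (eq (i, j))) * v i) • b j = 0 := by
    rw [← hsum, ← eq.sum_comp, Fintype.sum_prod_type_right]
    refine Finset.sum_congr rfl fun j _ => ?_
    rw [Finset.sum_smul]
    refine Finset.sum_congr rfl fun i _ => ?_
    rw [Algebra.smul_def, map_mul, aeval_algebraMap_apply]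
    simp [mul_assoc]
  have hz := Fintype.linearIndependent_iff.1 b.linearIndependent _ hsum2
  obtain ⟨p, hp⟩ := Function.ne_iff.1 hc
  refine ⟨fun i => c (eq (i, (eq.symm p).2)), ?_, hz _⟩
  refine Function.ne_iff.2 ⟨(eq.symm p).1, ?_⟩
  simpa using hp

section Sections

variable {K F : Type*} [Field K] [Field F] [Algebra K F]

theorem HasPolyRankBound.inv {x : F} (hx : x ≠ 0) {N : ℕ} (h : HasPolyRankBound K x N) :
    HasPolyRankBound K x⁻¹ N := by
  intro n hn v
  obtain ⟨c, hc, hsum⟩ := h hn v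
  set D := Finset.univ.sup fun i => (c i).natDegree with hD
  have hdeg : ∀ i, (c i).natDegree ≤ D := fun i =>
    Finset.le_sup (f := fun i => (c i).natDegree) (Finset.mem_univ i)
  refine ⟨fun i => reflect D (c i), ?_, ?_⟩
  · obtain ⟨i, hi⟩ := Function.ne_iff.1 hc
    exact Function.ne_iff.2 ⟨i, by simpa [reflect_eq_zero_iff] using hi⟩
  · let := invertibleOfNonzero hx
    refine (mul_eq_zero.1 (?_ : _ * x ^ D = 0)).resolve_right (pow_ne_zero _ hx)
    rw [← hsum, Finset.sum_mul]
    refine Finset.sum_congr rfl fun i _ => ?_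
    have := eval₂_reflect_mul_pow (algebraMap K F) x D (c i) (hdeg i)
    rw [aeval_def, aeval_def, ← this, invOf_eq_inv]
    ring

open Classical in
/-- A local generator at the valuation ring `V` of the fractional ideal `V + xV`, i.e. of the
polar divisor of `x`. -/
noncomputable def polarGenerator (x : F) (V : ValuationSubring F) : F := if x ∈ V then 1 else x

theorem polarGenerator_of_mem {x : F} {V : ValuationSubring F} (h : x ∈ V) :
    polarGenerator x V = 1 := if_pos h

theorem polarGenerator_of_notMem {x : F} {V : ValuationSubring F} (h : x ∉ V) :
    polarGenerator x V = x := if_neg h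

theorem inv_polarGenerator_mem (x : F) (V : ValuationSubring F) : (polarGenerator x V)⁻¹ ∈ V := by
  by_cases h : x ∈ V
  · simp [polarGenerator_of_mem h, one_mem]
  · rw [polarGenerator_of_notMem h]
    exact (V.mem_or_inv_mem x).resolve_left h

theorem pow_mul_inv_polarGenerator_pow_mem (x : F) (V : ValuationSubring F) {i j : ℕ}
    (h : i ≤ j) : x ^ i * (polarGenerator x V ^ j)⁻¹ ∈ V := by
  by_cases hx : x ∈ V
  · simpa [polarGenerator_of_mem hx] using pow_mem hx i
  · have hx0 : x ≠ 0 := by rintro rfl; exact hx (zero_mem _)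
    obtain ⟨l, rfl⟩ := Nat.exists_eq_add_of_le h
    rw [polarGenerator_of_notMem hx, show x ^ i * (x ^ (i + l))⁻¹ = x⁻¹ ^ l by
      rw [pow_add, mul_inv, ← mul_assoc, mul_inv_cancel₀ (pow_ne_zero _ hx0), one_mul, inv_pow]]
    exact pow_mem ((V.mem_or_inv_mem x).resolve_left hx) _

variable (K) in
/-- The space of functions whose poles are bounded by the divisor with local generators `D`. -/
def boundedPoles (D : ValuationSubring F → F) : Submodule K F where
  carrier := {z | ∀ V : ValuationSubring F, (∀ a, algebraMap K F a ∈ V) → z * (D V)⁻¹ ∈ V}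
  zero_mem' V _ := by simp [zero_mem]
  add_mem' ha hb V hV := by rw [add_mul]; exact add_mem (ha V hV) (hb V hV)
  smul_mem' c z hz V hV := by
    rw [Algebra.smul_def, mul_assoc]; exact mul_mem (hV c) (hz V hV)

theorem finrank_boundedPoles_mul_le (D : ValuationSubring F → F) {g : F} (hg : g ≠ 0) {e : ℕ}
    (he : HasPolyRankBound K g e) [FiniteDimensional K (boundedPoles K D)] :
    FiniteDimensional K (boundedPoles K fun V => D V * polarGenerator g V) ∧
      Module.finrank K (boundedPoles K fun V => D V * polarGenerator g V) ≤
        Module.finrank K (boundedPoles K D) + e := by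
  let V' : Submodule K F :=
    { carrier := {z | ∀ V : ValuationSubring F, (∀ a, algebraMap K F a ∈ V) → g ∉ V →
        z * (D V * g)⁻¹ ∈ V}
      zero_mem' := fun V _ => by simp [zero_mem]
      add_mem' := fun ha hb V hV h => by rw [add_mul]; exact add_mem (ha V hV h) (hb V hV h)
      smul_mem' := fun c z hz V hV h => by
        rw [Algebra.smul_def, mul_assoc]; exact mul_mem (hV c) (hz V hV h) }
  refine finrank_le_add_of_mul_mem (V' := V') (inv_ne_zero hg) (he.inv hg) ?_ ?_ ?_ ?_
  · intro z hz V hV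
    rw [mul_inv, ← mul_assoc]
    exact mul_mem (hz V hV) (inv_polarGenerator_mem g V)
  · intro z hz V hV h
    have : z * (D V * polarGenerator g V)⁻¹ ∈ V := hz V hV
    rwa [polarGenerator_of_notMem h] at this
  · intro y hy V hV h
    rw [mul_assoc]
    exact mul_mem ((V.mem_or_inv_mem g).resolve_left h) (hy V hV h)
  · intro y hy hty V hV
    by_cases h : g ∈ V
    · have : g⁻¹ * y * (D V * polarGenerator g V)⁻¹ ∈ V := hty V hV
      rwa [polarGenerator_of_mem h, mul_one] at this
    · have := hy V hV h
      rwa [mul_inv, mul_comm (D V)⁻¹, ← mul_assoc, mul_comm y] at this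

theorem finrank_boundedPoles_mul_pow_le (D : ValuationSubring F → F) {g : F} (hg : g ≠ 0) {e : ℕ}
    (he : HasPolyRankBound K g e) [FiniteDimensional K (boundedPoles K D)] (n : ℕ) :
    FiniteDimensional K (boundedPoles K fun V => D V * polarGenerator g V ^ n) ∧
      Module.finrank K (boundedPoles K fun V => D V * polarGenerator g V ^ n) ≤
        Module.finrank K (boundedPoles K D) + n * e := by
  induction n with
  | zero =>
    rw [show (fun V => D V * polarGenerator g V ^ 0) = D from funext fun V => by simp]
    exact ⟨‹_›, by simp⟩
  | succ n ih =>
    obtain ⟨h1, h2⟩ := ih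
    have := finrank_boundedPoles_mul_le (fun V => D V * polarGenerator g V ^ n) hg he
    rw [show (fun V => D V * polarGenerator g V ^ (n + 1)) =
      fun V => D V * polarGenerator g V ^ n * polarGenerator g V from
      funext fun V => by rw [pow_succ, mul_assoc]]
    refine ⟨this.1, this.2.trans ?_⟩
    rw [add_one_mul]
    omega

theorem isIntegral_of_forall_mem {z : F}
    (h : ∀ V : ValuationSubring F, (∀ a, algebraMap K F a ∈ V) → z ∈ V) : IsIntegral K z := by
  have hz : z ∈ (integralClosure (Subring.closure (Set.range (algebraMap K F))) F).toSubring := by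
    rw [← iInf_valuationSubring_superset, Subring.mem_iInf]
    exact fun V => h V.1 fun a => V.2 ⟨a, rfl⟩
  rw [show Subring.closure (Set.range (algebraMap K F)) = (⊥ : Subalgebra K F).toSubring by
    rw [← Algebra.adjoin_empty, Algebra.adjoin_eq_ring_closure, Set.union_empty]] at hz
  have hz' : IsIntegral (⊥ : Subalgebra K F) z := hz
  have : Algebra.IsIntegral K (⊥ : Subalgebra K F) := by
    refine ⟨fun a => ?_⟩
    obtain ⟨b, rfl⟩ := (Algebra.botEquiv K F).symm.surjective a
    exact (Algebra.IsIntegral.isIntegral (R := K) b).map (Algebra.botEquiv K F).symm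
  exact isIntegral_trans z hz'

theorem boundedPoles_one_le [IsAlgClosed K] :
    boundedPoles K (fun _ => (1 : F)) ≤ Submodule.span K {1} := by
  intro z hz
  have hint : IsIntegral K z := isIntegral_of_forall_mem fun V hV => by simpa using hz V hV
  have := (IsAlgClosed.algebraMap_bijective_of_isIntegral (k := K) (K := integralClosure K F)).2
    ⟨z, hint⟩
  obtain ⟨a, ha⟩ := this
  refine Submodule.mem_span_singleton.2 ⟨a, ?_⟩
  rw [← Algebra.algebraMap_eq_smul_one]
  exact congrArg Subtype.val ha

theorem finiteDimensional_boundedPoles [IsAlgClosed K] {x : F} (hx : x ≠ 0) {e : ℕ}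
    (he : HasPolyRankBound K x e) (n : ℕ) :
    FiniteDimensional K (boundedPoles K fun V => polarGenerator x V ^ n) := by
  have : FiniteDimensional K (boundedPoles K (fun _ => (1 : F))) :=
    Submodule.finiteDimensional_of_le boundedPoles_one_le
  have := (finrank_boundedPoles_mul_pow_le (fun _ => (1 : F)) hx he n).1
  rwa [show (fun V => 1 * polarGenerator x V ^ n) = fun V => polarGenerator x V ^ n from
    funext fun V => one_mul _] at this

theorem mul_finrank_boundedPoles_le {K F₁ F₂ : Type*} [Field K] [Field F₁] [Field F₂]
    [Algebra K F₁] [Algebra K F₂] [Algebra F₁ F₂] [IsScalarTower K F₁ F₂] (x : F₁) {g : F₂}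
    (hg : g ≠ 0) {e m : ℕ} (hm : LinearIndependent F₁ fun j : Fin m => g ^ (j : ℕ))
    (he : HasPolyRankBound K g e) (n : ℕ)
    [FiniteDimensional K (boundedPoles K fun V => polarGenerator x V ^ n)]
    [FiniteDimensional K (boundedPoles K fun V => polarGenerator (algebraMap F₁ F₂ x) V ^ n)] :
    m * Module.finrank K (boundedPoles K fun V => polarGenerator x V ^ n) ≤
      Module.finrank K (boundedPoles K fun V => polarGenerator (algebraMap F₁ F₂ x) V ^ n) +
        (m - 1) * e := by
  obtain ⟨hfin, hle⟩ := finrank_boundedPoles_mul_pow_le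
    (fun V => polarGenerator (algebraMap F₁ F₂ x) V ^ n) hg he (m - 1)
  refine le_trans ?_ hle
  let b := Module.finBasis K (boundedPoles K fun V => polarGenerator x V ^ n)
  have hb : LinearIndependent K fun i => (b i : F₁) :=
    b.linearIndependent.map' (Submodule.subtype _) (Submodule.ker_subtype _)
  have hbg := linearIndependent_smul hb hm
  have hmem : ∀ p : Fin (Module.finrank K (boundedPoles K fun V => polarGenerator x V ^ n)) × Fin m,
      (b p.1 : F₁) • g ^ (p.2 : ℕ) ∈ boundedPoles K fun V =>
        polarGenerator (algebraMap F₁ F₂ x) V ^ n * polarGenerator g V ^ (m - 1) := by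
    rintro ⟨i, j⟩ V hV
    have h1 := (b i).2 (V.comap (algebraMap F₁ F₂)) fun a => by
      rw [ValuationSubring.mem_comap, ← IsScalarTower.algebraMap_apply]; exact hV a
    rw [ValuationSubring.mem_comap, map_mul, map_inv₀, map_pow] at h1
    have h2 : algebraMap F₁ F₂ (polarGenerator x (V.comap (algebraMap F₁ F₂))) =
        polarGenerator (algebraMap F₁ F₂ x) V := by
      by_cases h : algebraMap F₁ F₂ x ∈ V
      · rw [polarGenerator_of_mem h, polarGenerator_of_mem (ValuationSubring.mem_comap.2 h), map_one]
      · rw [polarGenerator_of_notMem h,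
          polarGenerator_of_notMem (mt ValuationSubring.mem_comap.1 h)]
    rw [h2] at h1
    have h3 := pow_mul_inv_polarGenerator_pow_mem g V (show (j : ℕ) ≤ m - 1 by omega)
    have := mul_mem h1 h3
    rw [Algebra.smul_def, mul_inv]
    convert this using 1
    ring
  have hli : LinearIndependent K fun p => (⟨_, hmem p⟩ : boundedPoles K fun V =>
        polarGenerator (algebraMap F₁ F₂ x) V ^ n * polarGenerator g V ^ (m - 1)) :=
    LinearIndependent.of_comp (Submodule.subtype _) hbg
  have := hli.fintype_card_le_finrank
  simpa [mul_comm] using this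

end Sections

section Dedekind

variable {B F : Type*} [CommRing B] [Field F] [Algebra B F]

/-- The center on `B` of a valuation ring of `F` containing `B`. -/
def valuationCenter (B : Type*) {F : Type*} [CommRing B] [Field F] [Algebra B F]
    (V : ValuationSubring F) (hV : ∀ b : B, algebraMap B F b ∈ V) : Ideal B :=
  (IsLocalRing.maximalIdeal V).comap ((algebraMap B F).codRestrict V.toSubring hV)

variable {V : ValuationSubring F} {hV : ∀ b : B, algebraMap B F b ∈ V}

theorem mem_valuationCenter {b : B} :
    b ∈ valuationCenter B V hV ↔ V.valuation (algebraMap B F b) < 1 :=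
  Ideal.mem_comap.trans (V.valuation_lt_one_iff ⟨_, hV b⟩)

instance valuationCenter_isPrime : (valuationCenter B V hV).IsPrime :=
  Ideal.comap_isPrime _ _

theorem valuation_eq_one_of_notMem {b : B} (hb : b ∉ valuationCenter B V hV) :
    V.valuation (algebraMap B F b) = 1 := by
  rw [mem_valuationCenter, not_lt] at hb
  exact le_antisymm ((V.valuation_le_one_iff _).2 (hV b)) hb

theorem mem_of_mul_mem {b : B} (hb : b ∉ valuationCenter B V hV) {z : F}
    (h : algebraMap B F b * z ∈ V) : z ∈ V := by
  rw [← V.valuation_le_one_iff, map_mul, valuation_eq_one_of_notMem hb, one_mul] at h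
  rwa [← V.valuation_le_one_iff]

variable [IsDedekindDomain B] [IsFractionRing B F]

theorem valuationCenter_ne_bot (hne : V ≠ ⊤) : valuationCenter B V hV ≠ ⊥ := by
  intro h
  refine hne (top_unique fun z _ => ?_)
  obtain ⟨a, s, hs, rfl⟩ := IsFractionRing.div_surjective (A := B) z
  have hs' : s ∉ valuationCenter B V hV := by
    rw [h]
    simpa using nonZeroDivisors.ne_zero hs
  refine mem_of_mul_mem hs' ?_
  rw [mul_div_cancel₀ _ (by simpa using nonZeroDivisors.ne_zero hs)]
  exact hV a

theorem exists_mul_eq_mul_or {p : Ideal B} [p.IsPrime] (hp : p ≠ ⊥) (a s : B) :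
    ∃ c t : B, t ∉ p ∧ (s * c = a * t ∨ a * c = s * t) := by
  have := IsLocalization.AtPrime.isDiscreteValuationRing_of_dedekind_domain B hp
    (Localization.AtPrime p)
  have key : ∀ u w : B, algebraMap B (Localization.AtPrime p) u ∣ algebraMap B _ w →
      ∃ c t : B, t ∉ p ∧ u * c = w * t := by
    rintro u w ⟨r, hr⟩
    obtain ⟨⟨c, t⟩, hct⟩ := IsLocalization.surj p.primeCompl r
    refine ⟨c, t, t.2, ?_⟩
    apply IsLocalization.injective (Localization.AtPrime p) p.primeCompl_le_nonZeroDivisors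
    rw [map_mul, map_mul, hr, ← hct, mul_assoc]
  obtain h | h := ValuationRing.dvd_total (algebraMap B (Localization.AtPrime p) s)
    (algebraMap B (Localization.AtPrime p) a)
  · obtain ⟨c, t, ht, h⟩ := key _ _ h
    exact ⟨c, t, ht, .inl h⟩
  · obtain ⟨c, t, ht, h⟩ := key _ _ h
    exact ⟨c, t, ht, .inr h⟩

theorem le_of_valuationCenter_eq {W : ValuationSubring F} {hW : ∀ b : B, algebraMap B F b ∈ W}
    (hne : V ≠ ⊤) (h : valuationCenter B V hV = valuationCenter B W hW) : V ≤ W := by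
  intro z hz
  by_cases hz0 : z = 0
  · rw [hz0]; exact zero_mem _
  obtain ⟨a, s, hs, rfl⟩ := IsFractionRing.div_surjective (A := B) z
  have hs0 : algebraMap B F s ≠ 0 := by simpa using nonZeroDivisors.ne_zero hs
  have ha0 : algebraMap B F a ≠ 0 := fun h => hz0 (by simp [h])
  obtain ⟨c, t, ht, hct | hct⟩ := exists_mul_eq_mul_or (valuationCenter_ne_bot (hV := hV) hne) a s
  · have h1 := congrArg (algebraMap B F) hct
    rw [map_mul, map_mul] at h1
    refine mem_of_mul_mem (h ▸ ht) (?_ : _ ∈ W)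
    rw [← mul_div_assoc, mul_comm, ← h1, mul_div_cancel_left₀ _ hs0]
    exact hW c
  · have h1 := congrArg (algebraMap B F) hct
    rw [map_mul, map_mul] at h1
    have h2 : algebraMap B F a / algebraMap B F s * algebraMap B F c = algebraMap B F t := by
      rw [div_mul_eq_mul_div, h1, mul_div_cancel_left₀ _ hs0]
    have hc : c ∉ valuationCenter B V hV := by
      intro hc
      rw [mem_valuationCenter] at hc
      have h3 := congrArg V.valuation h2
      rw [map_mul, valuation_eq_one_of_notMem ht] at h3
      have := mul_lt_one_of_nonneg_of_lt_one_right ((V.valuation_le_one_iff _).2 hz) zero_le hc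
      rw [h3] at this
      exact lt_irrefl _ this
    refine mem_of_mul_mem (h ▸ hc) (?_ : _ ∈ W)
    rw [mul_comm, h2]
    exact hW t

theorem exists_sub_mem_and_forall_mem (hne : V ≠ ⊤) (hVB : ∀ b : B, algebraMap B F b ∈ V) (α : F) :
    ∃ f : F, f - α ∈ V ∧ ∀ W : ValuationSubring F, (∀ b : B, algebraMap B F b ∈ W) → W ≠ ⊤ →
      W ≠ V → f ∈ W := by
  classical
  set p := valuationCenter B V hVB with hp
  have hp0 : p ≠ ⊥ := valuationCenter_ne_bot hne
  obtain ⟨a, s, hs, rfl⟩ := IsFractionRing.div_surjective (A := B) α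
  have hs0 : s ≠ 0 := nonZeroDivisors.ne_zero hs
  have hs0' : algebraMap B F s ≠ 0 := by simpa using hs0
  have hD : Ideal.span {s} ≠ ⊥ := by simpa using hs0
  have hpp : Prime p := Ideal.prime_of_isPrime hp0 inferInstance
  obtain ⟨b, hD', hb⟩ := (FiniteMultiplicity.of_prime_left hpp hD).exists_eq_pow_mul_and_not_dvd
  set m := multiplicity p (Ideal.span {s})
  have hmax : p.IsMaximal := Ring.DimensionLEOne.maximalOfPrime hp0 inferInstance
  obtain ⟨w, hwb, hwp⟩ : ∃ w ∈ b, w ∉ p := by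
    by_contra! h
    exact hb (Ideal.dvd_iff_le.2 h)
  have htop : p ^ m ⊔ b = ⊤ := by
    rw [← Ideal.isCoprime_iff_sup_eq]
    refine IsCoprime.pow_left (Ideal.isCoprime_iff_sup_eq.2 ?_)
    exact hmax.1.2 _ (left_lt_sup.2 fun h => hb (Ideal.dvd_iff_le.2 h))
  obtain ⟨c, hc, b', hb', hcb⟩ := Submodule.mem_sup.1 ((Ideal.eq_top_iff_one _).1 htop)
  have key : ∀ u v : B, u ∈ p ^ m → v ∈ b → ∃ r : B,
      algebraMap B F u * algebraMap B F v * (algebraMap B F a / algebraMap B F s) =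
        algebraMap B F r := by
    intro u v hu hv
    have : u * v ∈ Ideal.span {s} := hD' ▸ Ideal.mul_mem_mul hu hv
    obtain ⟨r, hr⟩ := Ideal.mem_span_singleton'.1 this
    refine ⟨r * a, ?_⟩
    rw [← map_mul, ← hr, map_mul, map_mul]
    field_simp
  have hcb' : algebraMap B F c + algebraMap B F b' = 1 := by rw [← map_add, hcb, map_one]
  refine ⟨algebraMap B F b' * (algebraMap B F a / algebraMap B F s), ?_, ?_⟩
  · obtain ⟨r, hr⟩ := key c w hc hwb
    have h1 : algebraMap B F c * (algebraMap B F a / algebraMap B F s) ∈ V := by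
      refine mem_of_mul_mem hwp ?_
      rw [← mul_assoc, mul_comm (algebraMap B F w), hr]
      exact hVB r
    have h2 := neg_mem h1
    convert h2 using 1
    linear_combination (algebraMap B F a / algebraMap B F s) * hcb'
  · intro W hW hWne hWV
    have hq : ¬ p ≤ valuationCenter B W hW := by
      intro hle
      have := hmax.eq_of_le (valuationCenter_isPrime (hV := hW)).ne_top hle
      exact hWV (le_antisymm (le_of_valuationCenter_eq hWne this.symm)
        (le_of_valuationCenter_eq hne this))
    obtain ⟨u, hu, huq⟩ : ∃ u ∈ p ^ m, u ∉ valuationCenter B W hW := by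
      by_contra! h
      exact hq (Ideal.IsPrime.le_of_pow_le h)
    obtain ⟨r, hr⟩ := key u b' hu hb'
    refine mem_of_mul_mem huq ?_
    rw [← mul_assoc, hr]
    exact hW r

end Dedekind

section Algebraic

variable {A F : Type*} [CommRing A] [Field F] [Algebra A F] {N : ℕ}

theorem isAlgebraic_of_exists_sum_smul_eq_zero
    (hN : ∀ n : ℕ, N < n → ∀ v : Fin n → F, ∃ c : Fin n → A, c ≠ 0 ∧ ∑ i, c i • v i = 0) :
    Algebra.IsAlgebraic A F := by
  refine ⟨fun z => ?_⟩
  obtain ⟨c, hc, hsum⟩ := hN _ (Nat.lt_succ_self N) fun i => z ^ (i : ℕ)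
  refine ⟨∑ i : Fin (N + 1), monomial (i : ℕ) (c i), ?_, ?_⟩
  · obtain ⟨i, hi⟩ := Function.ne_iff.1 hc
    intro h
    have := congrArg (coeff · i) h
    simp [coeff_monomial, Fin.val_inj] at this
    exact hi this
  · simpa [aeval_monomial, ← Algebra.smul_def] using hsum

theorem isFractionRing_integralClosure [FaithfulSMul A F]
    (hN : ∀ n : ℕ, N < n → ∀ v : Fin n → F, ∃ c : Fin n → A, c ≠ 0 ∧ ∑ i, c i • v i = 0) :
    IsFractionRing (integralClosure A F) F :=
  have := isAlgebraic_of_exists_sum_smul_eq_zero hN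
  integralClosure.isFractionRing_of_algebraic fun x h => by simpa using h

end Algebraic

section IntegralClosure

variable {A B F : Type*} [CommRing A] [IsDomain A] [IsPrincipalIdealRing A] [Field F] [Algebra A F]
  [CommRing B] [IsDomain B] [Algebra A B] {N : ℕ}

theorem finite_quotient_map_of_exists_sum_smul_eq_zero [FaithfulSMul A B]
    (hN : ∀ n : ℕ, N < n → ∀ v : Fin n → B, ∃ c : Fin n → A, c ≠ 0 ∧ ∑ i, c i • v i = 0)
    (I : Ideal A) [I.IsMaximal] (hI : I ≠ ⊥) :
    Module.Finite (A ⧸ I) (B ⧸ I.map (algebraMap A B)) := by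
  classical
  let J := I.map (algebraMap A B)
  obtain ⟨π, hπ⟩ := (IsPrincipalIdealRing.principal I).principal
  have hπ' : I = Ideal.span {π} := hπ
  have hπ0 : π ≠ 0 := by rintro rfl; simp [hπ'] at hI
  have hπu : ¬ IsUnit π := by
    rw [← Ideal.span_singleton_eq_top, ← hπ']
    exact Ideal.IsPrime.ne_top'
  let := Ideal.Quotient.field I
  have hrank : Module.rank (A ⧸ I) (B ⧸ J) ≤ N := by
    refine rank_le fun s hs => ?_
    by_contra! hlt
    let e := s.equivFin.symm
    have hli : LinearIndependent (A ⧸ I)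
        (fun i : Fin s.card => ((e i : s) : B ⧸ J)) := hs.comp _ e.injective
    choose v hv using fun i : Fin s.card => Ideal.Quotient.mk_surjective (I := J) (e i : s).1
    obtain ⟨c, hc, hsum⟩ := hN _ hlt v
    obtain ⟨k, c', hcc', j, hj⟩ := exists_eq_pow_mul_not_dvd hπu hc
    have hsum' : ∑ i, c' i • v i = 0 := by
      have : algebraMap A B (π ^ k) * ∑ i, c' i • v i = 0 := by
        rw [← Algebra.smul_def, Finset.smul_sum, ← hsum]
        exact Finset.sum_congr rfl fun i _ => by rw [hcc' i, mul_smul]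
      refine (mul_eq_zero.1 this).resolve_left ?_
      simpa using fun h => (hπ0 h).elim
    have hz : ∑ i, (Ideal.Quotient.mk I (c' i)) • ((e i : s) : B ⧸ J) = 0 := by
      have := congrArg (Ideal.Quotient.mk J) hsum'
      rw [map_sum, map_zero] at this
      rw [← this]
      refine Finset.sum_congr rfl fun i _ => ?_
      rw [← hv i, Algebra.smul_def, Algebra.smul_def, map_mul]
      rfl
    have := Fintype.linearIndependent_iff.1 hli _ hz j
    rw [Ideal.Quotient.eq_zero_iff_mem, hπ', Ideal.mem_span_singleton] at this
    exact hj this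
  exact Module.rank_lt_aleph0_iff.1 (hrank.trans_lt Cardinal.natCast_lt_aleph0)

theorem isNoetherianRing_of_exists_sum_smul_eq_zero [FaithfulSMul A B] [Algebra.IsIntegral A B]
    (hN : ∀ n : ℕ, N < n → ∀ v : Fin n → B, ∃ c : Fin n → A, c ≠ 0 ∧ ∑ i, c i • v i = 0) :
    IsNoetherianRing B := by
  refine .of_prime_ne_bot fun P hP hP0 => ?_
  set I := P.comap (algebraMap A B) with hI
  have hI0 : I ≠ ⊥ := Ideal.IsIntegral.comap_ne_bot A hP0
  have hImax : I.IsMaximal := Ring.DimensionLEOne.maximalOfPrime hI0 inferInstance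
  have := finite_quotient_map_of_exists_sum_smul_eq_zero hN I hI0
  have hnoeth : IsNoetherianRing (B ⧸ I.map (algebraMap A B)) :=
    isNoetherian_of_tower (A ⧸ I) (isNoetherian_of_isNoetherianRing_of_finite _ _)
  refine Ideal.fg_of_fg_map_of_fg_inf_ker_of_surjective
    (f := Ideal.Quotient.mk (I.map (algebraMap A B)))
    (IsNoetherian.noetherian _) ?_ Ideal.Quotient.mk_surjective
  rw [Ideal.mk_ker, inf_eq_right.2 Ideal.map_comap_le]
  exact Ideal.FG.map (IsNoetherian.noetherian I) _

theorem isDedekindDomain_integralClosure [FaithfulSMul A F]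
    (hN : ∀ n : ℕ, N < n → ∀ v : Fin n → F, ∃ c : Fin n → A, c ≠ 0 ∧ ∑ i, c i • v i = 0) :
    IsDedekindDomain (integralClosure A F) := by
  have hnoeth : IsNoetherianRing (integralClosure A F) := by
    refine isNoetherianRing_of_exists_sum_smul_eq_zero (A := A) (N := N) fun n hn v => ?_
    obtain ⟨c, hc, hsum⟩ := hN n hn fun i => v i
    exact ⟨c, hc, Subtype.ext (by simpa using hsum)⟩
  have := isFractionRing_integralClosure hN
  have : IsDedekindRing (integralClosure A F) := by
    refine (isDedekindRing_iff _ F).2 ⟨hnoeth, inferInstance, fun {z} hz => ?_⟩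
    exact ⟨⟨z, isIntegral_trans (R := A) z hz⟩, rfl⟩
  exact {}

end IntegralClosure

section Places

theorem finite_setOf_notMem_of_isDedekindDomain {B F : Type*} [CommRing B] [Field F] [Algebra B F]
    [IsDedekindDomain B] [IsFractionRing B F] (z : F) :
    {V : ValuationSubring F | (∀ b : B, algebraMap B F b ∈ V) ∧ V ≠ ⊤ ∧ z ∉ V}.Finite := by
  classical
  obtain ⟨a, s, hs, rfl⟩ := IsFractionRing.div_surjective (A := B) z
  have hs0 : s ≠ 0 := nonZeroDivisors.ne_zero hs
  have hs0' : algebraMap B F s ≠ 0 := by simpa using hs0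
  have hfin := Ideal.finite_factors (I := Ideal.span {s}) (by simpa using hs0)
  refine Set.Finite.of_finite_image (f := fun V => if h : ∀ b : B, algebraMap B F b ∈ V then
    valuationCenter B V h else ⊥) ((hfin.image fun v => v.asIdeal).subset ?_) ?_
  · rintro _ ⟨V, ⟨hV, hne, hz⟩, rfl⟩
    refine ⟨⟨valuationCenter B V hV, inferInstance, valuationCenter_ne_bot hne⟩, ?_, by simp [hV]⟩
    refine Ideal.dvd_iff_le.2 ((Ideal.span_singleton_le_iff_mem _).2 ?_)
    by_contra h
    exact hz (mem_of_mul_mem h (by rw [mul_div_cancel₀ _ hs0']; exact hV a))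
  · rintro V ⟨hV, hVne, -⟩ W ⟨hW, hWne, -⟩ h
    simp only [hV, hW, implies_true, dite_true] at h
    exact le_antisymm (le_of_valuationCenter_eq hVne h) (le_of_valuationCenter_eq hWne h.symm)

variable {K F : Type*} [Field K] [Field F] [Algebra K F] {x : F} {N : ℕ}

theorem algebraMap_integralClosure_mem [Algebra K[X] F]
    (hx : ∀ p : K[X], algebraMap K[X] F p = aeval x p)
    {V : ValuationSubring F} (hV : ∀ a, algebraMap K F a ∈ V) (hxV : x ∈ V)
    (b : integralClosure K[X] F) : algebraMap (integralClosure K[X] F) F b ∈ V := by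
  have hpoly : ∀ p : K[X], aeval x p ∈ V := fun p => by
    rw [aeval_eq_sum_range]
    refine sum_mem fun i _ => ?_
    rw [Algebra.smul_def]
    exact mul_mem (hV _) (pow_mem hxV _)
  have hb : IsIntegral V (b : F) := by
    obtain ⟨p, hp, hpb⟩ := b.2
    refine ⟨p.map (RingHom.codRestrict (algebraMap K[X] F) V.toSubring fun q => ?_), hp.map _, ?_⟩
    · rw [hx]; exact hpoly q
    · rw [eval₂_map]; exact hpb
  obtain ⟨y, hy⟩ := (IsIntegrallyClosed.isIntegral_iff (R := V) (K := F)).1 hb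
  have := y.2
  rwa [show (y : F) = b from hy] at this

theorem isDedekindDomain_integralClosure_of_hasPolyRankBound [Algebra K[X] F]
    (hx : ∀ p : K[X], algebraMap K[X] F p = aeval x p) (hxt : Transcendental K x)
    (hN : HasPolyRankBound K x N) :
    IsDedekindDomain (integralClosure K[X] F) ∧ IsFractionRing (integralClosure K[X] F) F := by
  have hN' : ∀ n : ℕ, N < n → ∀ v : Fin n → F, ∃ c : Fin n → K[X], c ≠ 0 ∧ ∑ i, c i • v i = 0 := by
    intro n hn v
    obtain ⟨c, hc, h⟩ := hN hn v
    exact ⟨c, hc, by simpa [Algebra.smul_def, hx] using h⟩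
  have : FaithfulSMul K[X] F := by
    rw [faithfulSMul_iff_algebraMap_injective]
    intro p q h
    rw [hx, hx] at h
    exact transcendental_iff_injective.1 hxt h
  exact ⟨isDedekindDomain_integralClosure hN', isFractionRing_integralClosure hN'⟩

theorem exists_sub_mem_of_mem (hxt : Transcendental K x) (hN : HasPolyRankBound K x N)
    {V : ValuationSubring F} (hV : ∀ a, algebraMap K F a ∈ V) (hne : V ≠ ⊤) (hxV : x ∈ V) (α : F) :
    ∃ f : F, f - α ∈ V ∧ ∀ W : ValuationSubring F, (∀ a, algebraMap K F a ∈ W) → x ∈ W → W ≠ ⊤ →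
      W ≠ V → f ∈ W := by
  let := (aeval (R := K) x).toRingHom.toAlgebra
  have hx : ∀ p : K[X], algebraMap K[X] F p = aeval x p := fun p => rfl
  obtain ⟨_, _⟩ := isDedekindDomain_integralClosure_of_hasPolyRankBound hx hxt hN
  obtain ⟨f, hf, h⟩ := exists_sub_mem_and_forall_mem hne
    (algebraMap_integralClosure_mem hx hV hxV) α
  exact ⟨f, hf, fun W hW hxW => h W (algebraMap_integralClosure_mem hx hW hxW)⟩

theorem transcendental_inv_s10 (hxt : Transcendental K x) : Transcendental K x⁻¹ :=
  fun h => hxt (by simpa using h.inv)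

theorem Transcendental.ne_zero' (hxt : Transcendental K x) : x ≠ 0 := by
  rintro rfl
  exact hxt isAlgebraic_zero

theorem finite_setOf_notMem (hxt : Transcendental K x) (hN : HasPolyRankBound K x N) (z : F) :
    {V : ValuationSubring F | (∀ a, algebraMap K F a ∈ V) ∧ V ≠ ⊤ ∧ z ∉ V}.Finite := by
  have key : ∀ w : F, Transcendental K w → HasPolyRankBound K w N →
      {V : ValuationSubring F | (∀ a, algebraMap K F a ∈ V) ∧ w ∈ V ∧ V ≠ ⊤ ∧ z ∉ V}.Finite := by
    intro w hw hwN
    let := (aeval (R := K) w).toRingHom.toAlgebra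
    have hx : ∀ p : K[X], algebraMap K[X] F p = aeval w p := fun p => rfl
    obtain ⟨_, _⟩ := isDedekindDomain_integralClosure_of_hasPolyRankBound hx hw hwN
    refine (finite_setOf_notMem_of_isDedekindDomain (B := integralClosure K[X] F) z).subset ?_
    rintro V ⟨hV, hwV, h⟩
    exact ⟨algebraMap_integralClosure_mem hx hV hwV, h⟩
  refine ((key x hxt hN).union (key x⁻¹ (transcendental_inv_s10 hxt) (hN.inv hxt.ne_zero'))).subset ?_
  rintro V ⟨hV, h⟩
  obtain hxV | hxV := V.mem_or_inv_mem x
  · exact .inl ⟨hV, hxV, h⟩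
  · exact .inr ⟨hV, hxV, h⟩

variable (K) in
open Classical in
/-- The family equal to `h` at the poles of `x` and to `0` at all other places. -/
noncomputable def polarFamily (x : F) : F →ₗ[K] (FFPlace K F → F) where
  toFun h P := if x ∈ P.asSubring then 0 else h
  map_add' a b := by ext P; by_cases h : x ∈ P.asSubring <;> simp [h]
  map_smul' c a := by ext P; by_cases h : x ∈ P.asSubring <;> simp [h]

theorem polarFamily_apply_of_mem {P : FFPlace K F} (h : x ∈ P.asSubring) (a : F) :
    polarFamily K x a P = 0 := if_pos h

theorem polarFamily_apply_of_notMem {P : FFPlace K F} (h : x ∉ P.asSubring) (a : F) :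
    polarFamily K x a P = a := if_neg h

theorem FFPlace.asSubring_injective :
    Function.Injective (FFPlace.asSubring : FFPlace K F → ValuationSubring F) := by
  rintro ⟨P, _, _⟩ ⟨Q, _, _⟩ rfl
  rfl

theorem finite_setOf_notMem_asSubring (hxt : Transcendental K x) (hN : HasPolyRankBound K x N)
    (z : F) : {P : FFPlace K F | z ∉ P.asSubring}.Finite :=
  .of_finite_image ((finite_setOf_notMem hxt hN z).subset (by
    rintro _ ⟨P, hP, rfl⟩
    exact ⟨P.algebraMap_mem, P.ne_top, hP⟩)) FFPlace.asSubring_injective.injOn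

theorem polarFamily_mem_adeleSubmodule {y : F} (h : {P : FFPlace K F | y ∉ P.asSubring}.Finite)
    (a : F) : polarFamily K y a ∈ adeleSubmodule K F := by
  refine h.subset fun P hP hy => hP ?_
  rw [polarFamily_apply_of_mem hy]
  exact zero_mem _

theorem mem_principalAdeles (f : F) : (fun _ => f) ∈ principalAdeles K F := ⟨f, rfl⟩

theorem single_mem_sup_range_polarFamily [DecidableEq (FFPlace K F)] (hxt : Transcendental K x)
    (hN : HasPolyRankBound K x N) (P : FFPlace K F) (a : F) :
    Pi.single P a ∈ integralAdeles K F ⊔ principalAdeles K F ⊔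
      LinearMap.range (polarFamily K x) := by
  by_cases hxP : x ∈ P.asSubring
  · obtain ⟨f, hf, h⟩ := exists_sub_mem_of_mem hxt hN P.algebraMap_mem P.ne_top hxP a
    have h1 : Pi.single P a - (fun _ => f) + polarFamily K x f ∈ integralAdeles K F := by
      intro Q
      simp only [Pi.add_apply, Pi.sub_apply]
      by_cases hxQ : x ∈ Q.asSubring
      · rw [polarFamily_apply_of_mem hxQ, add_zero]
        by_cases hQP : Q = P
        · subst hQP
          rw [Pi.single_eq_same, ← neg_sub]
          exact neg_mem hf
        · rw [Pi.single_eq_of_ne hQP, zero_sub]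
          exact neg_mem (h _ Q.algebraMap_mem hxQ Q.ne_top
            fun h => hQP (FFPlace.asSubring_injective h))
      · rw [polarFamily_apply_of_notMem hxQ, Pi.single_eq_of_ne (by rintro rfl; exact hxQ hxP)]
        simp [zero_mem]
    rw [show (Pi.single P a : FFPlace K F → F) =
      (Pi.single P a - (fun _ => f) + polarFamily K x f) + (fun _ => f) - polarFamily K x f by abel]
    exact sub_mem (Submodule.mem_sup_left (Submodule.add_mem_sup h1 (mem_principalAdeles f)))
      (Submodule.mem_sup_right ⟨f, rfl⟩)
  · have hinv : ∀ Q : FFPlace K F, x ∉ Q.asSubring → x⁻¹ ∈ Q.asSubring := fun Q h =>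
      (Q.asSubring.mem_or_inv_mem x).resolve_left h
    obtain ⟨f, hf, h⟩ := exists_sub_mem_of_mem (transcendental_inv_s10 hxt) (hN.inv hxt.ne_zero')
      P.algebraMap_mem P.ne_top (hinv P hxP) a
    have h1 : Pi.single P a - polarFamily K x f ∈ integralAdeles K F := by
      intro Q
      simp only [Pi.sub_apply]
      by_cases hxQ : x ∈ Q.asSubring
      · rw [polarFamily_apply_of_mem hxQ, Pi.single_eq_of_ne (by rintro rfl; exact hxP hxQ)]
        simp [zero_mem]
      · rw [polarFamily_apply_of_notMem hxQ]
        by_cases hQP : Q = P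
        · subst hQP
          rw [Pi.single_eq_same, ← neg_sub]
          exact neg_mem hf
        · rw [Pi.single_eq_of_ne hQP, zero_sub]
          exact neg_mem (h _ Q.algebraMap_mem (hinv Q hxQ) Q.ne_top
            fun h => hQP (FFPlace.asSubring_injective h))
    rw [← sub_add_cancel (Pi.single P a) (polarFamily K x f)]
    exact Submodule.add_mem_sup (Submodule.mem_sup_left h1) ⟨f, rfl⟩

theorem adeleSubmodule_le_sup_range_polarFamily (hxt : Transcendental K x)
    (hN : HasPolyRankBound K x N) :
    adeleSubmodule K F ≤ integralAdeles K F ⊔ principalAdeles K F ⊔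
      LinearMap.range (polarFamily K x) := by
  classical
  intro α hα
  have hfin : {P : FFPlace K F | α P ∉ P.asSubring}.Finite := hα
  have h1 : α - ∑ P ∈ hfin.toFinset, Pi.single P (α P) ∈ integralAdeles K F := by
    intro Q
    rw [Pi.sub_apply, Finset.sum_apply]
    by_cases hQ : α Q ∈ Q.asSubring
    · rw [Finset.sum_eq_zero, sub_zero]
      · exact hQ
      · intro P hP
        refine Pi.single_eq_of_ne ?_ _
        rintro rfl
        exact (hfin.mem_toFinset.1 hP) hQ
    · rw [Finset.sum_eq_single_of_mem Q (hfin.mem_toFinset.2 hQ)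
        fun P _ h => Pi.single_eq_of_ne h.symm _, Pi.single_eq_same, sub_self]
      exact zero_mem _
  rw [← sub_add_cancel α (∑ P ∈ hfin.toFinset, Pi.single P (α P))]
  exact add_mem (Submodule.mem_sup_left (Submodule.mem_sup_left h1))
    (sum_mem fun P _ => single_mem_sup_range_polarFamily hxt hN P _)

variable (K) in
/-- Among any `G + 1` elements of `F` there is a nontrivial `K`-linear combination which is the sum
of an element with poles only at the poles of `x` and an element without poles there. -/
def HasPolarDefect (x : F) (G : ℕ) : Prop :=
  ∀ v : Fin (G + 1) → F, ∃ c : Fin (G + 1) → K, c ≠ 0 ∧ ∃ f : F,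
    (∀ V : ValuationSubring F, (∀ a, algebraMap K F a ∈ V) → x ∈ V → f ∈ V) ∧
    ∀ V : ValuationSubring F, (∀ a, algebraMap K F a ∈ V) → x ∉ V → ∑ i, c i • v i - f ∈ V

theorem HasPolarDefect.exists_sum_smul_mem {G : ℕ} (h : HasPolarDefect K x G)
    (hxt : Transcendental K x) (hN : HasPolyRankBound K x N)
    {v : Fin (G + 1) → FFPlace K F → F} (hv : ∀ i, v i ∈ adeleSubmodule K F) :
    ∃ c : Fin (G + 1) → K, c ≠ 0 ∧ ∑ i, c i • v i ∈ integralAdeles K F ⊔ principalAdeles K F := by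
  have h1 := fun i => Submodule.mem_sup.1 (adeleSubmodule_le_sup_range_polarFamily hxt hN (hv i))
  choose t ht p hp htp using h1
  choose w hw using hp
  obtain ⟨c, hc, f, hf, hf'⟩ := h w
  refine ⟨c, hc, ?_⟩
  simp_rw [← htp, smul_add, Finset.sum_add_distrib]
  refine add_mem (sum_mem fun i _ => Submodule.smul_mem _ _ (ht i)) ?_
  simp_rw [← hw, ← map_smul, ← map_sum]
  rw [← sub_add_cancel (polarFamily K x _) (fun _ => f)]
  refine Submodule.add_mem_sup (fun P => ?_) (mem_principalAdeles f)
  rw [Pi.sub_apply]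
  by_cases hx : x ∈ P.asSubring
  · rw [polarFamily_apply_of_mem hx, zero_sub]
    exact neg_mem (hf _ P.algebraMap_mem hx)
  · rw [polarFamily_apply_of_notMem hx]
    exact hf' _ P.algebraMap_mem hx

theorem HasPolarDefect.of_transcendental {G : ℕ} (h : HasPolarDefect K x G)
    (hxt : Transcendental K x) (hN : HasPolyRankBound K x N) (y : F) : HasPolarDefect K y G := by
  intro v
  obtain ⟨c, hc, hmem⟩ := h.exists_sum_smul_mem hxt hN (v := fun i => polarFamily K y (v i))
    fun i => polarFamily_mem_adeleSubmodule (finite_setOf_notMem_asSubring hxt hN y) _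
  refine ⟨c, hc, ?_⟩
  obtain ⟨t, ht, _, ⟨f, rfl⟩, hsum⟩ := Submodule.mem_sup.1 hmem
  simp_rw [← map_smul, ← map_sum] at hsum
  refine ⟨f, fun V hV hy => ?_, fun V hV hy => ?_⟩
  · by_cases hne : V = ⊤
    · rw [hne]; trivial
    have h1 := congrFun hsum ⟨V, hV, hne⟩
    rw [polarFamily_apply_of_mem (by exact hy)] at h1
    rw [show f = -t ⟨V, hV, hne⟩ from (neg_eq_of_add_eq_zero_right h1).symm]
    exact neg_mem (ht ⟨V, hV, hne⟩)
  · by_cases hne : V = ⊤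
    · rw [hne]; trivial
    have h1 := congrFun hsum ⟨V, hV, hne⟩
    rw [polarFamily_apply_of_notMem (by exact hy)] at h1
    rw [← h1]
    change t ⟨V, hV, hne⟩ + f - f ∈ V
    rw [add_sub_cancel_right]
    exact ht ⟨V, hV, hne⟩

theorem genus_le_of_hasPolarDefect {G : ℕ} (h : HasPolarDefect K x G)
    (hxt : Transcendental K x) (hN : HasPolyRankBound K x N) : genus K F ≤ G := by
  classical
  refine Module.finrank_le_of_rank_le (rank_le fun s hs => ?_)
  by_contra! hlt
  obtain ⟨s', hs', hcard⟩ := Finset.exists_subset_card_eq hlt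
  let e := (s'.equivFinOfCardEq hcard).symm
  have hli := hs.comp (fun i => (⟨e i, hs' (e i).2⟩ : s)) fun i j hij =>
    e.injective (Subtype.ext (congrArg (fun a : s => a.1) hij))
  choose v hv using fun i => Submodule.Quotient.mk_surjective _ ((e i : s').1)
  obtain ⟨c, hc, hmem⟩ := h.exists_sum_smul_mem hxt hN fun i => (v i).2
  refine hc (funext (Fintype.linearIndependent_iff.1 hli c ?_))
  simp only [Function.comp_apply, ← hv]
  have : Submodule.Quotient.mk (p := (integralAdeles K F ⊔ principalAdeles K F).comap
      (adeleSubmodule K F).subtype) (∑ i, c i • v i) = 0 := by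
    rw [Submodule.Quotient.mk_eq_zero]
    simpa using hmem
  rw [← this]
  exact (map_sum (Submodule.mkQ _) _ _).symm

end Places

section

variable {K F : Type*} [Field K] [Field F] [Algebra K F] {x : F} {N : ℕ}

theorem HasPolyRankBound.exists_aeval_mul_mem (hN : HasPolyRankBound K x N) (z : F) :
    ∃ a : K[X], a ≠ 0 ∧ ∀ V : ValuationSubring F, (∀ a, algebraMap K F a ∈ V) → x ∈ V →
      aeval x a * z ∈ V := by
  let := (aeval (R := K) x).toRingHom.toAlgebra
  have hx : ∀ p : K[X], algebraMap K[X] F p = aeval x p := fun p => rfl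
  have : Algebra.IsAlgebraic K[X] F :=
    isAlgebraic_of_exists_sum_smul_eq_zero (N := N) fun n hn v => by
      obtain ⟨c, hc, h⟩ := hN hn v
      exact ⟨c, hc, by simpa [Algebra.smul_def, hx] using h⟩
  obtain ⟨a, ha, hint⟩ := (Algebra.IsAlgebraic.isAlgebraic (R := K[X]) z).exists_integral_multiple
  refine ⟨a, ha, fun V hV hxV => ?_⟩
  have := algebraMap_integralClosure_mem hx hV hxV ⟨_, hint⟩
  rwa [← hx, ← Algebra.smul_def]

theorem HasPolyRankBound.exists_inv_pow_mul_mem (hxt : Transcendental K x)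
    (hN : HasPolyRankBound K x N) (z : F) :
    ∃ n : ℕ, ∀ V : ValuationSubring F, (∀ a, algebraMap K F a ∈ V) → x ∉ V →
      x⁻¹ ^ n * z ∈ V := by
  obtain ⟨a, ha, h⟩ := (hN.inv hxt.ne_zero').exists_aeval_mul_mem z
  obtain ⟨n, c, hc, _, hX⟩ := exists_eq_pow_mul_not_dvd (ι := Unit) (c := fun _ => a)
    (not_isUnit_X (R := K)) fun h => ha (congrFun h ())
  refine ⟨n, fun V hV hxV => ?_⟩
  have hxV' := (V.mem_or_inv_mem x).resolve_left hxV
  have h1 := h V hV hxV'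
  rw [hc (), map_mul, map_pow, aeval_X] at h1
  have hx1 : V.valuation x⁻¹ < 1 := by
    rw [← V.valuation_le_one_iff, not_le] at hxV
    rw [map_inv₀]
    exact inv_lt_one_of_one_lt₀ hxV
  have h0 : (c ()).coeff 0 ≠ 0 := fun h => hX (X_dvd_iff.2 h)
  have hunit : V.valuation (aeval x⁻¹ (c ())) = 1 := by
    have hconst : V.valuation (algebraMap K F ((c ()).coeff 0)) = 1 := by
      refine le_antisymm ((V.valuation_le_one_iff _).2 (hV _)) ?_
      have := (V.valuation_le_one_iff _).2 (hV ((c ()).coeff 0)⁻¹)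
      rwa [map_inv₀, map_inv₀, inv_le_one₀ ((Valuation.pos_iff _).2 (by simpa using h0))] at this
    have hlt : V.valuation (x⁻¹ * aeval x⁻¹ (c ()).divX) < 1 := by
      rw [map_mul]
      refine mul_lt_one_of_lt_of_le hx1 ((V.valuation_le_one_iff _).2 ?_)
      rw [aeval_eq_sum_range]
      refine sum_mem fun i _ => ?_
      rw [Algebra.smul_def]
      exact mul_mem (hV _) (pow_mem hxV' _)
    rw [← X_mul_divX_add (c ()), map_add, map_mul, aeval_X, aeval_C,
      Valuation.map_add_eq_of_lt_right _ (by rwa [hconst]), hconst]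
  rw [← V.valuation_le_one_iff] at h1 ⊢
  rwa [mul_right_comm, map_mul, hunit, mul_one] at h1

/-- The functions whose pole order at each pole of `x` is at most `n` times that of `x`. -/
def polarRegular (K : Type*) {F : Type*} [Field K] [Field F] [Algebra K F] (x : F) (n : ℕ) :
    Submodule K F where
  carrier := {z | ∀ V : ValuationSubring F, (∀ a, algebraMap K F a ∈ V) → x ∉ V → x⁻¹ ^ n * z ∈ V}
  zero_mem' V _ _ := by simp [zero_mem]
  add_mem' ha hb V hV h := by rw [mul_add]; exact add_mem (ha V hV h) (hb V hV h)
  smul_mem' c z hz V hV h := by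
    rw [Algebra.smul_def, mul_left_comm]; exact mul_mem (hV c) (hz V hV h)

theorem mem_polarRegular {n : ℕ} {z : F} : z ∈ polarRegular K x n ↔
    ∀ V : ValuationSubring F, (∀ a, algebraMap K F a ∈ V) → x ∉ V → x⁻¹ ^ n * z ∈ V := Iff.rfl

theorem polarRegular_mono {m n : ℕ} (h : m ≤ n) : polarRegular K x m ≤ polarRegular K x n := by
  intro z hz V hV hx
  obtain ⟨l, rfl⟩ := Nat.exists_eq_add_of_le h
  rw [pow_add, mul_comm (_ ^ m), mul_assoc]
  exact mul_mem (pow_mem ((V.mem_or_inv_mem x).resolve_left hx) _) (hz V hV hx)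

theorem inv_mul_mem_polarRegular_iff {n : ℕ} {z : F} :
    x⁻¹ * z ∈ polarRegular K x n ↔ z ∈ polarRegular K x (n + 1) := by
  simp only [mem_polarRegular, pow_succ, mul_assoc]

theorem finrank_inf_polarRegular_le (hx : x ≠ 0) (hN : HasPolyRankBound K x N)
    (S : Submodule K F) [FiniteDimensional K (S ⊓ polarRegular K x 0 : Submodule K F)] (n : ℕ) :
    FiniteDimensional K (S ⊓ polarRegular K x n : Submodule K F) ∧
      Module.finrank K (S ⊓ polarRegular K x n : Submodule K F) ≤
        Module.finrank K (S ⊓ polarRegular K x 0 : Submodule K F) + n * N := by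
  induction n with
  | zero => exact ⟨‹_›, by simp⟩
  | succ n ih =>
    obtain ⟨_, h2⟩ := ih
    obtain ⟨h3, h4⟩ := finrank_le_add_of_mul_mem (inv_ne_zero hx) (hN.inv hx)
      (W := S ⊓ polarRegular K x n) (V := S ⊓ polarRegular K x (n + 1))
      (V' := polarRegular K x (n + 1))
      (inf_le_inf_left _ (polarRegular_mono n.le_succ)) inf_le_right
      (fun y hy => polarRegular_mono n.le_succ (inv_mul_mem_polarRegular_iff.2 hy))
      (fun y hy h => ⟨h.1, inv_mul_mem_polarRegular_iff.2 hy⟩)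
    exact ⟨h3, by rw [add_one_mul]; omega⟩

theorem hasPolarDefect_of_forall_le_finrank [IsAlgClosed K] (hxt : Transcendental K x)
    (hN : HasPolyRankBound K x N) {G : ℕ}
    (h : ∀ n : ℕ, n * N + 1 ≤
      Module.finrank K (boundedPoles K fun V => polarGenerator x V ^ n) + G) :
    HasPolarDefect K x G := by
  intro v
  by_contra! hcon
  have hind : ∀ c : Fin (G + 1) → K, ∀ f : F,
      (∀ V : ValuationSubring F, (∀ a, algebraMap K F a ∈ V) → x ∈ V → f ∈ V) →
      (∀ V : ValuationSubring F, (∀ a, algebraMap K F a ∈ V) → x ∉ V →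
        ∑ i, c i • v i - f ∈ V) → c = 0 := by
    intro c f hf hf'
    by_contra hc
    obtain ⟨V, hV, hx, hV'⟩ := hcon c hc f hf
    exact hV' (hf' V hV hx)
  choose m hm using fun i => hN.exists_inv_pow_mul_mem hxt (v i)
  set n := Finset.univ.sup m with hn
  set L := boundedPoles K fun V => polarGenerator x V ^ n with hL
  have hLO : ∀ z ∈ L, ∀ V : ValuationSubring F, (∀ a, algebraMap K F a ∈ V) → x ∈ V → z ∈ V := by
    intro z hz V hV hx
    have : z * (polarGenerator x V ^ n)⁻¹ ∈ V := hz V hV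
    rwa [polarGenerator_of_mem hx, one_pow, inv_one, mul_one] at this
  have hLR : L ≤ polarRegular K x n := by
    intro z hz V hV hx
    have : z * (polarGenerator x V ^ n)⁻¹ ∈ V := hz V hV
    rwa [polarGenerator_of_notMem hx, ← inv_pow, mul_comm] at this
  have hLfin : FiniteDimensional K L := finiteDimensional_boundedPoles hxt.ne_zero' hN n
  have hli : LinearIndependent K v := by
    refine Fintype.linearIndependent_iff.2 fun c hc i => ?_
    exact congrFun (hind c 0 (fun V _ _ => zero_mem _) fun V _ _ => by
      rw [hc, sub_zero]; exact zero_mem _) i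
  have hdisj : L ⊓ Submodule.span K (Set.range v) = ⊥ := by
    rw [eq_bot_iff]
    rintro z ⟨hz, hzv⟩
    obtain ⟨c, rfl⟩ := (Submodule.mem_span_range_iff_exists_fun K).1 hzv
    have := hind c _ (hLO _ hz) fun V _ _ => by rw [sub_self]; exact zero_mem _
    simp [this]
  have hvfin : FiniteDimensional K (Submodule.span K (Set.range v)) :=
    FiniteDimensional.span_of_finite _ (Set.finite_range v)
  set S := L ⊔ Submodule.span K (Set.range v) with hS
  have hrankS : Module.finrank K S = Module.finrank K L + (G + 1) := by
    have := Submodule.finrank_sup_add_finrank_inf_eq L (Submodule.span K (Set.range v))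
    rw [hdisj, finrank_bot, finrank_span_eq_card hli, Fintype.card_fin] at this
    simpa using this
  have hSR : S ⊓ polarRegular K x n = S := by
    refine inf_eq_left.2 (sup_le hLR (Submodule.span_le.2 ?_))
    rintro _ ⟨i, rfl⟩
    exact polarRegular_mono (Finset.le_sup (Finset.mem_univ i))
      (show v i ∈ polarRegular K x (m i) from hm i)
  have hS0 : S ⊓ polarRegular K x 0 ≤ Submodule.span K {1} := by
    rintro r ⟨hrS, hr⟩
    obtain ⟨l, hl, w, hw, rfl⟩ := Submodule.mem_sup.1 hrS
    obtain ⟨c, rfl⟩ := (Submodule.mem_span_range_iff_exists_fun K).1 hw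
    have hc : c = 0 := by
      refine hind c (-l) (fun V hV hx => neg_mem (hLO l hl V hV hx)) fun V hV hx => ?_
      rw [sub_neg_eq_add, add_comm]
      simpa using hr V hV hx
    subst hc
    simp only [Pi.zero_apply, zero_smul, Finset.sum_const_zero, add_zero] at hr ⊢
    refine boundedPoles_one_le fun V hV => ?_
    rw [inv_one, mul_one]
    by_cases hx : x ∈ V
    · exact hLO l hl V hV hx
    · simpa using hr V hV hx
  have hS0fin : FiniteDimensional K (S ⊓ polarRegular K x 0 : Submodule K F) :=
    Submodule.finiteDimensional_of_le hS0
  have h0 : Module.finrank K (S ⊓ polarRegular K x 0 : Submodule K F) ≤ 1 :=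
    (Submodule.finrank_mono hS0).trans (finrank_span_singleton one_ne_zero).le
  have h1 := (finrank_inf_polarRegular_le hxt.ne_zero' hN S n).2
  rw [hSR, hrankS] at h1
  have h2 : n * N + 1 ≤ Module.finrank K L + G := h n
  omega

end

section PushoutBasis

variable {R S T U ι : Type*} [CommRing R] [CommRing S] [CommRing T] [CommRing U] [Algebra R S]
  [Algebra R T] [Algebra R U] [Algebra S U] [Algebra T U] [IsScalarTower R S U]
  [IsScalarTower R T U] [Algebra.IsPushout R S T U]

variable (S U) in
/-- The `S`-basis of the pushout of `S` and `T` over `R` induced by an `R`-basis of `T`. -/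
noncomputable def Algebra.IsPushout.basis (b : Module.Basis ι R T) : Module.Basis ι S U :=
  (b.baseChange S).map (Algebra.IsPushout.equiv R S T U).toLinearEquiv

theorem Algebra.IsPushout.basis_apply (b : Module.Basis ι R T) (i : ι) :
    Algebra.IsPushout.basis S U b i = algebraMap T U (b i) := by
  simp [Algebra.IsPushout.basis, Algebra.IsPushout.equiv_tmul]

theorem Algebra.IsPushout.basis_repr (b : Module.Basis ι R T) (s : S) (t : T) (i : ι) :
    (Algebra.IsPushout.basis S U b).repr (algebraMap S U s * algebraMap T U t) i =
      b.repr t i • s := by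
  have : (Algebra.IsPushout.equiv R S T U).symm (algebraMap S U s * algebraMap T U t) =
      s ⊗ₜ[R] t := by
    rw [AlgEquiv.symm_apply_eq, Algebra.IsPushout.equiv_tmul]
  simp [Algebra.IsPushout.basis, this]

end PushoutBasis

theorem Algebra.IsPushout.induction_on (R S T : Type*) {U : Type*} [CommRing R] [CommRing S]
    [CommRing T] [CommRing U] [Algebra R S] [Algebra R T] [Algebra R U] [Algebra S U]
    [Algebra T U] [IsScalarTower R S U] [IsScalarTower R T U] [Algebra.IsPushout R S T U]
    {motive : U → Prop} (u : U)
    (mul : ∀ s t, motive (algebraMap S U s * algebraMap T U t))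
    (add : ∀ x y, motive x → motive y → motive (x + y)) : motive u := by
  obtain ⟨z, rfl⟩ := (Algebra.IsPushout.equiv R S T U).surjective u
  induction z using TensorProduct.induction_on with
  | zero => simpa using mul 0 0
  | tmul s t => rw [Algebra.IsPushout.equiv_tmul]; exact mul s t
  | add x y hx hy => rw [map_add]; exact add _ _ hx hy

section Descent

variable {k Ω F M : Type*} [Field k] [Field Ω] [Field F] [Field M] [Algebra k Ω] [Algebra k F]
  [Algebra k M] [Algebra Ω M] [Algebra F M] [IsScalarTower k Ω M] [IsScalarTower k F M]

theorem basis_repr_mem_of_mem_span {ι : Type*} [Algebra.IsPushout k F Ω M]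
    (b : Module.Basis ι k Ω) (U : Submodule k F) {m : M}
    (hm : m ∈ Submodule.span Ω (algebraMap F M '' U)) (i : ι) :
    (Algebra.IsPushout.basis F M b).repr m i ∈ U := by
  obtain ⟨n, c, g, rfl⟩ := Submodule.mem_span_set'.1 hm
  rw [map_sum, Finsupp.finsetSum_apply]
  refine sum_mem fun j _ => ?_
  obtain ⟨u, hu, hg⟩ := (g j).2
  rw [← hg, Algebra.smul_def, mul_comm, Algebra.IsPushout.basis_repr]
  exact U.smul_mem _ hu

theorem exists_sum_smul_mem_of_mem_span [Algebra.IsPushout k F Ω M] (U : Submodule k F) {n : ℕ}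
    {v : Fin n → F} {c : Fin n → Ω} (hc : c ≠ 0)
    (h : ∑ i, c i • algebraMap F M (v i) ∈ Submodule.span Ω (algebraMap F M '' U)) :
    ∃ c' : Fin n → k, c' ≠ 0 ∧ ∑ i, c' i • v i ∈ U := by
  let b := Module.Free.chooseBasis k Ω
  obtain ⟨j, hj⟩ := Function.ne_iff.1 hc
  obtain ⟨i, hi⟩ : ∃ i, b.repr (c j) i ≠ 0 := by
    by_contra! h
    exact hj (b.repr.map_eq_zero_iff.1 (Finsupp.ext h))
  refine ⟨fun j => b.repr (c j) i, Function.ne_iff.2 ⟨j, hi⟩, ?_⟩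
  have := basis_repr_mem_of_mem_span b U h i
  rw [map_sum, Finsupp.finsetSum_apply] at this
  convert this using 2 with l
  rw [Algebra.smul_def (c l), mul_comm, Algebra.IsPushout.basis_repr]

section Subfield

variable {E : IntermediateField k F} {E' : IntermediateField Ω M}

theorem linearIndependent_algebraMap_comp [Algebra.IsPushout k F Ω M]
    (h : ∀ m ∈ E', m ∈ Submodule.span Ω (algebraMap F M '' E)) {ι : Type*} {v : ι → F}
    (hv : LinearIndependent E v) : LinearIndependent E' (algebraMap F M ∘ v) := by
  let b := Module.Free.chooseBasis k Ω
  rw [linearIndependent_iff']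
  intro s g hg i hi
  rw [← ZeroMemClass.coe_eq_zero, ← (Algebra.IsPushout.basis F M b).repr.map_eq_zero_iff]
  ext j
  have hmem : ∀ l, (Algebra.IsPushout.basis F M b).repr (g l : M) j ∈ E := fun l =>
    basis_repr_mem_of_mem_span b (Subalgebra.toSubmodule E.toSubalgebra) (h _ (g l).2) j
  have h0 : ∑ l ∈ s, (⟨_, hmem l⟩ : E) • v l = 0 := by
    have := congrArg (fun m => (Algebra.IsPushout.basis F M b).repr m j) hg
    simp only [map_sum, Finsupp.finsetSum_apply, map_zero, Finsupp.zero_apply] at this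
    rw [← this]
    refine Finset.sum_congr rfl fun l _ => ?_
    change _ = (Algebra.IsPushout.basis F M b).repr ((g l : M) * algebraMap F M (v l)) j
    rw [mul_comm, ← Algebra.smul_def, map_smul, Finsupp.smul_apply, smul_eq_mul, mul_comm]
    rfl
  exact congrArg Subtype.val (linearIndependent_iff'.1 hv s _ h0 i hi)

theorem finrank_eq_of_isPushout [Algebra.IsPushout k Ω F M] [Algebra.IsPushout k F Ω M]
    (hle : ∀ a ∈ E, algebraMap F M a ∈ E')
    (h : ∀ m ∈ E', m ∈ Submodule.span Ω (algebraMap F M '' E)) :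
    Module.finrank E F = Module.finrank E' M := by
  let b := Module.Free.chooseBasis E F
  have hspan : ⊤ ≤ Submodule.span E' (Set.range (algebraMap F M ∘ b)) := by
    rintro m -
    refine Algebra.IsPushout.induction_on k Ω F
      (motive := (· ∈ Submodule.span E' (Set.range (algebraMap F M ∘ b)))) m (fun s t => ?_)
      fun _ _ => add_mem
    · have hs : algebraMap Ω M s ∈ E' := E'.algebraMap_mem s
      refine (Submodule.span E' _).smul_mem (⟨_, hs⟩ : E') ?_
      rw [← b.linearCombination_repr t, Finsupp.linearCombination_apply, Finsupp.sum, map_sum]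
      refine sum_mem fun i _ => ?_
      rw [show b.repr t i • b i = (b.repr t i : F) * b i from rfl, map_mul]
      exact (Submodule.span E' _).smul_mem (⟨_, hle _ (b.repr t i).2⟩ : E')
        (Submodule.subset_span ⟨i, rfl⟩)
  rw [Module.finrank_eq_nat_card_basis b, Module.finrank_eq_nat_card_basis
    (Module.Basis.mk (linearIndependent_algebraMap_comp h b.linearIndependent) hspan)]

end Subfield

section Galois

/-- The action of the Galois group on the second factor of a pushout. -/
noncomputable def conjugation (F M : Type*) [Field F] [Field M] [Algebra k F]
    [Algebra k M] [Algebra Ω M] [Algebra F M] [IsScalarTower k Ω M] [IsScalarTower k F M]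
    [Algebra.IsPushout k F Ω M] (σ : Ω ≃ₐ[k] Ω) : M ≃ₐ[F] M :=
  (Algebra.IsPushout.equiv k F Ω M).symm.trans
    ((Algebra.TensorProduct.congr AlgEquiv.refl σ).trans (Algebra.IsPushout.equiv k F Ω M))

theorem conjugation_algebraMap [Algebra.IsPushout k F Ω M] (σ : Ω ≃ₐ[k] Ω) (a : Ω) :
    conjugation F M σ (algebraMap Ω M a) = algebraMap Ω M (σ a) := by
  simp [conjugation, Algebra.IsPushout.equiv_symm_algebraMap_right, Algebra.IsPushout.equiv_tmul]

theorem basis_repr_conjugation [Algebra.IsPushout k F Ω M] [Algebra.IsPushout k Ω F M] {ι : Type*}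
    (b : Module.Basis ι k F) (σ : Ω ≃ₐ[k] Ω) (m : M) (i : ι) :
    (Algebra.IsPushout.basis Ω M b).repr (conjugation F M σ m) i =
      σ ((Algebra.IsPushout.basis Ω M b).repr m i) := by
  refine Algebra.IsPushout.induction_on k Ω F (motive := fun m =>
    (Algebra.IsPushout.basis Ω M b).repr (conjugation F M σ m) i =
      σ ((Algebra.IsPushout.basis Ω M b).repr m i)) m (fun s t => ?_) fun x y hx hy => ?_
  · rw [map_mul, conjugation_algebraMap, AlgEquiv.commutes, Algebra.IsPushout.basis_repr,
      Algebra.IsPushout.basis_repr, map_smul]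
  · simp [hx, hy]

theorem mem_span_of_conjugation_stable [IsGalois k Ω] [Algebra.IsPushout k F Ω M]
    [Algebra.IsPushout k Ω F M] (W : Submodule Ω M)
    (hW : ∀ σ : Ω ≃ₐ[k] Ω, ∀ w ∈ W, conjugation F M σ w ∈ W) {w : M} (hw : w ∈ W) :
    w ∈ Submodule.span Ω (algebraMap F M '' {z | algebraMap F M z ∈ W}) := by
  classical
  let b := Module.Free.chooseBasis k F
  let B := Algebra.IsPushout.basis Ω M b
  induction hn : (B.repr w).support.card using Nat.strong_induction_on generalizing w with
  | _ n ih =>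
  by_cases hw0 : w = 0
  · rw [hw0]; exact zero_mem _
  -- an element of minimal support inside the support of `w`
  have hex : ∃ n : ℕ, ∃ u ∈ W, u ≠ 0 ∧ (B.repr u).support ⊆ (B.repr w).support ∧
      (B.repr u).support.card = n := ⟨_, w, hw, hw0, subset_rfl, rfl⟩
  obtain ⟨u, hu, hu0, hsupp, hcard⟩ := Nat.find_spec hex
  have hmin : ∀ z ∈ W, (B.repr z).support ⊆ (B.repr w).support →
      (B.repr z).support.card < Nat.find hex → z = 0 := by
    intro z hz hz' hlt
    by_contra hz0
    exact Nat.find_min hex hlt ⟨z, hz, hz0, hz', rfl⟩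
  obtain ⟨i, hi⟩ : (B.repr u).support.Nonempty := by
    rw [Finsupp.support_nonempty_iff]
    exact fun h => hu0 (B.repr.map_eq_zero_iff.1 h)
  have hi' := Finsupp.mem_support_iff.1 hi
  set y := (B.repr u i)⁻¹ • u with hy
  have hyW : y ∈ W := W.smul_mem _ hu
  have hrepr : B.repr y = (B.repr u i)⁻¹ • B.repr u := by rw [hy, map_smul]
  have hysupp : (B.repr y).support = (B.repr u).support := by
    rw [hrepr, Finsupp.support_smul_eq (inv_ne_zero hi')]
  have hyi : B.repr y i = 1 := by
    rw [hrepr, Finsupp.smul_apply, smul_eq_mul, inv_mul_cancel₀ hi']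
  have hfix : ∀ σ : Ω ≃ₐ[k] Ω, conjugation F M σ y = y := by
    intro σ
    have hsub : (B.repr (conjugation F M σ y - y)).support ⊆ (B.repr u).support.erase i := by
      intro j hj
      rw [map_sub, Finsupp.mem_support_iff, Finsupp.sub_apply, basis_repr_conjugation] at hj
      refine Finset.mem_erase.2 ⟨?_, ?_⟩
      · rintro rfl
        exact hj (by rw [hyi, map_one, sub_self])
      · rw [← hysupp, Finsupp.mem_support_iff]
        intro h
        exact hj (by rw [h, map_zero, sub_self])
    refine sub_eq_zero.1 (hmin _ (sub_mem (hW σ y hyW) hyW)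
      (hsub.trans ((Finset.erase_subset _ _).trans hsupp)) ?_)
    refine (Finset.card_le_card hsub).trans_lt ?_
    rw [← hcard]
    exact Finset.card_erase_lt_of_mem hi
  have hrange : ∀ j, ∃ a : k, algebraMap k Ω a = B.repr y j := by
    intro j
    refine (InfiniteGalois.mem_range_algebraMap_iff_fixed (k := k) _).2 fun σ => ?_
    rw [← basis_repr_conjugation, hfix]
  choose a ha using hrange
  have hyF : ∃ z : F, algebraMap F M z = y := by
    refine ⟨∑ j ∈ (B.repr y).support, a j • b j, ?_⟩
    conv_rhs => rw [← B.linearCombination_repr y, Finsupp.linearCombination_apply, Finsupp.sum]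
    rw [map_sum]
    refine Finset.sum_congr rfl fun j _ => ?_
    rw [← ha, Algebra.IsPushout.basis_apply, Algebra.smul_def, Algebra.smul_def, map_mul,
      ← IsScalarTower.algebraMap_apply, ← IsScalarTower.algebraMap_apply]
  obtain ⟨z, hz⟩ := hyF
  have hyspan : y ∈ Submodule.span Ω (algebraMap F M '' {z | algebraMap F M z ∈ W}) :=
    Submodule.subset_span ⟨z, by rw [Set.mem_ofPred_eq, hz]; exact hyW, hz⟩
  rw [← sub_add_cancel w (B.repr w i • y)]
  refine add_mem (ih _ ?_ (sub_mem hw (W.smul_mem _ hyW)) rfl) (Submodule.smul_mem _ _ hyspan)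
  rw [← hn]
  refine Finset.card_lt_card (Finset.ssubset_iff_of_subset ?_ |>.2 ⟨i, hsupp hi, ?_⟩)
  · intro j hj
    rw [Finsupp.mem_support_iff] at hj ⊢
    intro h
    have hj' : B.repr y j = 0 := by
      rw [← Finsupp.notMem_support_iff, hysupp]
      exact fun hju => Finsupp.mem_support_iff.1 (hsupp hju) h
    exact hj (by rw [map_sub, map_smul, Finsupp.sub_apply, Finsupp.smul_apply, h, hj']; simp)
  · rw [Finsupp.notMem_support_iff, map_sub, map_smul, Finsupp.sub_apply, Finsupp.smul_apply, hyi]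
    simp

end Galois

end Descent

theorem ValuationSubring.exists_comap_eq {F M : Type*} [Field F] [Field M] [Algebra F M]
    (V : ValuationSubring F) : ∃ W : ValuationSubring M, W.comap (algebraMap F M) = V := by
  obtain ⟨W, h, hloc⟩ := IsLocalRing.exists_factor_valuationRing ((algebraMap F M).comp V.subtype)
  refine ⟨W, SetLike.ext fun z => ⟨fun hz => ?_, fun hz => h ⟨z, hz⟩⟩⟩
  by_contra hzV
  have hz0 : z ≠ 0 := by rintro rfl; exact hzV (zero_mem _)
  have hinv : z⁻¹ ∈ V := (V.mem_or_inv_mem z).resolve_left hzV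
  have hunit : IsUnit (⟨z⁻¹, hinv⟩ : V) := by
    refine hloc.map_nonunit _ (isUnit_iff_exists_inv.2 ⟨⟨algebraMap F M z, hz⟩, ?_⟩)
    refine Subtype.ext ?_
    change algebraMap F M z⁻¹ * algebraMap F M z = 1
    rw [← map_mul, inv_mul_cancel₀ hz0, map_one]
  obtain ⟨u, hu⟩ := isUnit_iff_exists_inv.1 hunit
  have hu' : z⁻¹ * (u : F) = 1 := congrArg Subtype.val hu
  rw [inv_mul_eq_one₀ hz0] at hu'
  exact hzV (hu' ▸ u.2)

theorem ValuationSubring.algebraMap_mem_of_isAlgebraic {k Ω M : Type*} [Field k] [Field Ω]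
    [Field M] [Algebra k Ω] [Algebra k M] [Algebra Ω M] [IsScalarTower k Ω M]
    [Algebra.IsAlgebraic k Ω] {W : ValuationSubring M} (hW : ∀ a, algebraMap k M a ∈ W) (a : Ω) :
    algebraMap Ω M a ∈ W := by
  obtain ⟨p, hp, hpa⟩ := (Algebra.IsIntegral.isIntegral (R := k) a).algebraMap (B := M)
  let i : k →+* W := (algebraMap k M).codRestrict W.toSubring hW
  have hint : IsIntegral W (algebraMap Ω M a) := by
    refine ⟨p.map i, hp.map i, ?_⟩
    rw [eval₂_map]
    exact hpa
  obtain ⟨w, hw⟩ := IsIntegrallyClosed.isIntegral_iff.1 hint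
  rw [← hw]
  exact w.2

/-- The functions without poles at the places satisfying `P`. -/
def regularFunctions (K : Type*) {F : Type*} [Field K] [Field F] [Algebra K F]
    (P : ValuationSubring F → Prop) : Submodule K F where
  carrier := {z | ∀ V : ValuationSubring F, (∀ a, algebraMap K F a ∈ V) → P V → z ∈ V}
  zero_mem' V _ _ := zero_mem _
  add_mem' ha hb V hV hP := add_mem (ha V hV hP) (hb V hV hP)
  smul_mem' c z hz V hV hP := by rw [Algebra.smul_def]; exact mul_mem (hV c) (hz V hV hP)

theorem hasPolarDefect_iff {K F : Type*} [Field K] [Field F] [Algebra K F] {x : F} {G : ℕ} :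
    HasPolarDefect K x G ↔ ∀ v : Fin (G + 1) → F, ∃ c : Fin (G + 1) → K, c ≠ 0 ∧
      ∑ i, c i • v i ∈ regularFunctions K (fun V => x ∈ V) ⊔
        regularFunctions K fun V => x ∉ V := by
  refine forall_congr' fun v => exists_congr fun c => and_congr_right fun _ => ?_
  rw [Submodule.mem_sup]
  constructor
  · rintro ⟨f, hf, h⟩
    exact ⟨f, hf, _, h, add_sub_cancel _ _⟩
  · rintro ⟨f, hf, g, hg, h⟩
    exact ⟨f, hf, by rwa [← h, add_sub_cancel_left]⟩

section Descent

variable {k Ω F M : Type*} [Field k] [Field Ω] [Field F] [Field M] [Algebra k Ω] [Algebra k F]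
  [Algebra k M] [Algebra Ω M] [Algebra F M] [IsScalarTower k Ω M] [IsScalarTower k F M]

theorem regularFunctions_le_span [IsGalois k Ω] [Algebra.IsPushout k F Ω M]
    [Algebra.IsPushout k Ω F M] (P : ValuationSubring F → Prop) :
    regularFunctions Ω (fun W : ValuationSubring M => P (W.comap (algebraMap F M))) ≤
      Submodule.span Ω (algebraMap F M '' regularFunctions k P) := by
  intro w hw
  refine Submodule.span_mono (Set.image_mono ?_)
    (mem_span_of_conjugation_stable (k := k) _ (fun σ z hz W hW hP => ?_) hw)
  · intro z hz V hV hP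
    obtain ⟨W, rfl⟩ := V.exists_comap_eq (M := M)
    refine hz W (ValuationSubring.algebraMap_mem_of_isAlgebraic (k := k) fun a => ?_) hP
    rw [IsScalarTower.algebraMap_apply k F M]
    exact hV a
  · refine hz (W.comap (conjugation F M σ).toRingEquiv.toRingHom) (fun a => ?_) ?_
    · rw [ValuationSubring.mem_comap]
      change conjugation F M σ _ ∈ W
      rw [conjugation_algebraMap]
      exact hW _
    · have hcomap : (W.comap (conjugation F M σ).toRingEquiv.toRingHom).comap (algebraMap F M) =
          W.comap (algebraMap F M) := by
        ext z
        simp [ValuationSubring.mem_comap]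
      change P _
      rwa [hcomap]

theorem HasPolarDefect.of_isPushout [IsGalois k Ω] [Algebra.IsPushout k F Ω M]
    [Algebra.IsPushout k Ω F M] {y : F} {G : ℕ} (h : HasPolarDefect Ω (algebraMap F M y) G) :
    HasPolarDefect k y G := by
  rw [hasPolarDefect_iff] at h ⊢
  intro v
  obtain ⟨c, hc, hmem⟩ := h fun i => algebraMap F M (v i)
  refine exists_sum_smul_mem_of_mem_span _ hc ((sup_le ?_ ?_ : _ ≤ Submodule.span Ω _) hmem)
  · exact (regularFunctions_le_span fun V => y ∈ V).trans
      (Submodule.span_mono (Set.image_mono (SetLike.coe_subset_coe.2 le_sup_left)))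
  · exact (regularFunctions_le_span fun V => y ∉ V).trans
      (Submodule.span_mono (Set.image_mono (SetLike.coe_subset_coe.2 le_sup_right)))

end Descent

theorem Algebra.IsPushout.of_bijective_lift {R S T U : Type*} [CommRing R] [CommRing S]
    [CommRing T] [CommRing U] [Algebra R S] [Algebra R T] [Algebra R U] [Algebra S U] [Algebra T U]
    [IsScalarTower R S U] [IsScalarTower R T U] (φ : TensorProduct R S T →ₐ[S] U)
    (hφ : ∀ t, φ (1 ⊗ₜ[R] t) = algebraMap T U t) (h : Function.Bijective φ) :
    Algebra.IsPushout R S T U :=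
  ⟨.of_equiv (AlgEquiv.ofBijective φ h).toLinearEquiv hφ⟩

theorem isField_tensorProduct_of_isAlgebraic (k L F : Type*) [Field k] [Field L] [Field F]
    [Algebra k L] [Algebra k F] [Algebra.IsAlgebraic k L] [IsDomain (TensorProduct k L F)] :
    IsField (TensorProduct k L F) := by
  have : IsDomain (TensorProduct k F L) :=
    (Algebra.TensorProduct.comm k F L).toMulEquiv.isDomain _
  exact (Algebra.TensorProduct.comm k L F).toMulEquiv.isField
    (isField_of_isIntegral_of_isField' (R := F) (Field.toIsField F))

theorem isPushout_of_isFractionRing_tensorProduct {k L F K : Type*} [Field k] [Field L] [Field F]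
    [Field K] [Algebra k L] [Algebra k F] [Algebra.IsAlgebraic k L]
    [IsDomain (TensorProduct k L F)] [Algebra (TensorProduct k L F) K]
    [IsFractionRing (TensorProduct k L F) K] [Algebra L K] [IsScalarTower L (TensorProduct k L F) K]
    [Algebra F K] [Algebra k K] [IsScalarTower k L K] [IsScalarTower k F K]
    (hF : ∀ a : F, algebraMap F K a = algebraMap (TensorProduct k L F) K (1 ⊗ₜ[k] a)) :
    Algebra.IsPushout k L F K :=
  .of_bijective_lift (IsScalarTower.toAlgHom L (TensorProduct k L F) K) (fun t => (hF t).symm)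
    (IsField.localization_map_bijective zero_notMem_nonZeroDivisors
      (isField_tensorProduct_of_isAlgebraic k L F))

section Subfield

variable {k Ω F M : Type*} [Field k] [Field Ω] [Field F] [Field M] [Algebra k Ω] [Algebra k F]
  [Algebra k M] [Algebra Ω M] [Algebra F M] [IsScalarTower k Ω M] [IsScalarTower k F M]

theorem Algebra.IsPushout.of_mem_span {E E' : Type*} [Field E] [Field E'] [Algebra k E]
    [Algebra E F] [IsScalarTower k E F] [Algebra Ω E'] [Algebra E' M] [IsScalarTower Ω E' M]
    [Algebra k E'] [IsScalarTower k Ω E'] [Algebra E E'] [IsScalarTower k E E']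
    [Algebra.IsPushout k Ω F M]
    (hcomm : ∀ a : E, algebraMap E' M (algebraMap E E' a) = algebraMap F M (algebraMap E F a))
    (h : ∀ m : E', m ∈ Submodule.span Ω (Set.range (algebraMap E E'))) :
    Algebra.IsPushout k Ω E E' := by
  let φ : TensorProduct k Ω E →ₐ[Ω] E' :=
    Algebra.TensorProduct.lift (Algebra.ofId Ω E') (IsScalarTower.toAlgHom k E E')
      fun _ _ => Commute.all _ _
  have hφ : ∀ t, φ (1 ⊗ₜ[k] t) = algebraMap E E' t := fun t => by simp [φ]
  refine .of_bijective_lift φ hφ ⟨?_, fun m => ?_⟩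
  · let ψ : TensorProduct k Ω E →ₐ[Ω] TensorProduct k Ω F :=
      Algebra.TensorProduct.map (AlgHom.id Ω Ω) (IsScalarTower.toAlgHom k E F)
    have hψ : Function.Injective ψ :=
      Module.Flat.lTensor_preserves_injective_linearMap (M := Ω)
        (IsScalarTower.toAlgHom k E F).toLinearMap (algebraMap E F).injective
    have hcomp : (IsScalarTower.toAlgHom Ω E' M).comp φ =
        (Algebra.IsPushout.equiv k Ω F M).toAlgHom.comp ψ := by
      ext a
      simp [φ, ψ, Algebra.IsPushout.equiv_tmul, hcomm]
    refine Function.Injective.of_comp (f := IsScalarTower.toAlgHom Ω E' M) ?_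
    rw [← AlgHom.coe_comp, hcomp]
    exact (Algebra.IsPushout.equiv k Ω F M).injective.comp hψ
  · have hle : Submodule.span Ω (Set.range (algebraMap E E')) ≤ LinearMap.range φ.toLinearMap := by
      rw [Submodule.span_le]
      rintro _ ⟨a, rfl⟩
      exact ⟨1 ⊗ₜ[k] a, hφ a⟩
    exact hle (h m)

theorem adjoin_singleton_le_span [Algebra.IsAlgebraic k Ω] (f : F) {m : M}
    (hm : m ∈ IntermediateField.adjoin Ω {algebraMap F M f}) :
    m ∈ Submodule.span Ω (algebraMap F M '' IntermediateField.adjoin k {f}) := by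
  set E := IntermediateField.adjoin k {f} with hE
  set A := Algebra.adjoin Ω (algebraMap F M '' E) with hA
  have hint : ∀ a ∈ A, IsIntegral E a := by
    intro a ha
    induction ha using Algebra.adjoin_induction with
    | mem a ha =>
      obtain ⟨b, hb, rfl⟩ := ha
      exact isIntegral_algebraMap (x := (⟨b, hb⟩ : E))
    | algebraMap r =>
      exact ((Algebra.IsIntegral.isIntegral (R := k) r).algebraMap (B := M)).tower_top
    | add _ _ _ _ h1 h2 => exact h1.add h2
    | mul _ _ _ _ h1 h2 => exact h1.mul h2
  have hinv : ∀ a ∈ A, a⁻¹ ∈ A := by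
    intro a ha
    have := (hint a ha).inv_mem_adjoin
    refine Algebra.adjoin_induction (fun x hx => ?_) (fun r => ?_) (fun _ _ _ _ => add_mem)
      (fun _ _ _ _ => mul_mem) this
    · rw [Set.mem_singleton_iff.1 hx]; exact ha
    · exact Algebra.subset_adjoin ⟨r, r.2, rfl⟩
  have hle : IntermediateField.adjoin Ω {algebraMap F M f} ≤
      A.toIntermediateField hinv := by
    rw [IntermediateField.adjoin_le_iff, Set.singleton_subset_iff]
    exact Algebra.subset_adjoin ⟨f, IntermediateField.mem_adjoin_simple_self k f, rfl⟩
  have hmem : m ∈ Subalgebra.toSubmodule A := hle hm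
  rw [hA, Algebra.adjoin_eq_span] at hmem
  have hclosure : (Submonoid.closure (algebraMap F M '' E) : Set M) = algebraMap F M '' E := by
    refine congrArg SetLike.coe (Submonoid.closure_eq
      (E.toSubalgebra.toSubsemiring.toSubmonoid.map (algebraMap F M).toMonoidHom))
  rwa [hclosure] at hmem

theorem finrank_adjoin_singleton_eq [Algebra.IsPushout k Ω F M] [Algebra.IsPushout k F Ω M]
    [Algebra.IsAlgebraic k Ω] (f : F) :
    Module.finrank (IntermediateField.adjoin Ω {algebraMap F M f}) M =
      Module.finrank (IntermediateField.adjoin k {f}) F := by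
  refine (finrank_eq_of_isPushout (k := k) (fun a ha => ?_) fun m =>
    adjoin_singleton_le_span (k := k) f).symm
  let E : IntermediateField k F :=
    ((IntermediateField.adjoin Ω {algebraMap F M f}).restrictScalars k).comap
      (IsScalarTower.toAlgHom k F M)
  have : IntermediateField.adjoin k {f} ≤ E := by
    rw [IntermediateField.adjoin_le_iff, Set.singleton_subset_iff]
    exact IntermediateField.mem_adjoin_simple_self Ω (algebraMap F M f)
  exact this ha

end Subfield

section Growth

variable {K F : Type*} [Field K] [Field F] [Algebra K F]

theorem succ_le_finrank_boundedPoles {x : F} (hx : Transcendental K x) (n : ℕ)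
    [FiniteDimensional K (boundedPoles K fun V => polarGenerator x V ^ n)] :
    n + 1 ≤ Module.finrank K (boundedPoles K fun V => polarGenerator x V ^ n) := by
  have hpow : LinearIndependent K fun i : ℕ => x ^ i := by
    have := (linearIndependent_powers_iff_aeval (LinearMap.mulLeft K x) 1).2 fun p hp => by
      by_contra hp0
      refine hx ⟨p, hp0, ?_⟩
      have h : aeval (LinearMap.mulLeft K x) p = LinearMap.mulLeft K (aeval x p) :=
        (aeval_algHom_apply (Algebra.lmul K F) x p)
      simpa [h] using hp
    simpa [LinearMap.pow_mulLeft] using this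
  have hmem : ∀ i : Fin (n + 1), x ^ (i : ℕ) ∈ boundedPoles K fun V => polarGenerator x V ^ n :=
    fun i V _ => pow_mul_inv_polarGenerator_pow_mem x V (Nat.lt_succ_iff.1 i.2)
  have hli : LinearIndependent K fun i : Fin (n + 1) =>
      (⟨_, hmem i⟩ : boundedPoles K fun V => polarGenerator x V ^ n) :=
    .of_comp (Submodule.subtype _) (hpow.comp (fun i : Fin (n + 1) => (i : ℕ)) Fin.val_injective)
  simpa using hli.fintype_card_le_finrank

theorem mul_add_one_le_finrank_boundedPoles {K F₁ F₂ : Type*} [Field K] [IsAlgClosed K] [Field F₁]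
    [Field F₂] [Algebra K F₁] [Algebra K F₂] [Algebra F₁ F₂] [IsScalarTower K F₁ F₂] {x : F₁}
    {g : F₂} (hx : x ≠ 0) (hg : g ≠ 0) {e m : ℕ} (he : 0 < e) (hm : 0 < m)
    (hli : LinearIndependent F₁ fun j : Fin m => g ^ (j : ℕ)) (hx₁ : HasPolyRankBound K x e)
    (hx₂ : HasPolyRankBound K (algebraMap F₁ F₂ x) (m * e)) (hg₂ : HasPolyRankBound K g (m * e))
    {n : ℕ} (h : n * e + 1 ≤
      Module.finrank K (boundedPoles K fun V => polarGenerator x V ^ n) + (e - 1) ^ 2) :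
    n * (m * e) + 1 ≤
      Module.finrank K (boundedPoles K fun V => polarGenerator (algebraMap F₁ F₂ x) V ^ n) +
        (m * e - 1) ^ 2 := by
  have := finiteDimensional_boundedPoles hx hx₁ n
  have := finiteDimensional_boundedPoles (x := algebraMap F₁ F₂ x) (by simpa using hx) hx₂ n
  have key := mul_finrank_boundedPoles_le x hg hli hg₂ n
  generalize Module.finrank K (boundedPoles K fun V => polarGenerator x V ^ n) = a at *
  generalize Module.finrank K
    (boundedPoles K fun V => polarGenerator (algebraMap F₁ F₂ x) V ^ n) = b at *
  have hme : 1 ≤ m * e := Nat.mul_pos hm he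
  zify [he, hm, hme] at h key ⊢
  have hm' : (0 : ℤ) ≤ m - 1 := by linarith [(by exact_mod_cast hm : (1 : ℤ) ≤ m)]
  have he' : (0 : ℤ) ≤ e - 1 := by linarith [(by exact_mod_cast he : (1 : ℤ) ≤ e)]
  have h1 : (0 : ℤ) ≤ m * (m - 1) * (e * (e - 1)) := by positivity
  have h2 := mul_le_mul_of_nonneg_left h (Int.natCast_nonneg m)
  linarith

end Growth

section Maximal

variable {K M : Type*} [Field K] [Field M] [Algebra K M] {x : M} {d : ℕ}

/-- The subfield `E` contains `x`, has index `d / e`, and the multiples of the pole divisor of `x`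
on `E` have at least the dimension expected of a field of genus `(e - 1) ^ 2`. -/
structure HasControlledGrowth (x : M) (d e : ℕ) (E : IntermediateField K M) : Prop where
  mem : x ∈ E
  mul_finrank : e * Module.finrank E M = d
  le_finrank : ∀ n : ℕ, n * e + 1 ≤
    Module.finrank K (boundedPoles K fun V => polarGenerator (⟨x, mem⟩ : E) V ^ n) + (e - 1) ^ 2

theorem HasControlledGrowth.hasPolyRankBound {e : ℕ} {E : IntermediateField K M}
    (h : HasControlledGrowth x d e E) (hd : 0 < d) {y : M} (hy : HasPolyRankBound K y d)
    (hyE : y ∈ E) : HasPolyRankBound K (⟨y, hyE⟩ : E) e := by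
  have : FiniteDimensional E M :=
    Module.finite_of_finrank_pos (pos_of_mul_pos_right (h.mul_finrank ▸ hd) (Nat.zero_le e))
  exact .of_tower (M := M) h.mul_finrank hy

theorem hasControlledGrowth_adjoin [IsAlgClosed K] (hx : Transcendental K x) (hd : 0 < d)
    (hxd : Module.finrank (IntermediateField.adjoin K {x}) M = d) :
    HasControlledGrowth x d 1 (IntermediateField.adjoin K {x}) := by
  have hmem := IntermediateField.mem_adjoin_simple_self K x
  have : FiniteDimensional (IntermediateField.adjoin K {x}) M :=
    Module.finite_of_finrank_pos (hxd ▸ hd)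
  refine ⟨hmem, by rw [one_mul, hxd], fun n => ?_⟩
  have hx' : Transcendental K (⟨x, hmem⟩ : IntermediateField.adjoin K {x}) :=
    fun h => hx (h.algebraMap (A := M))
  have hxd' : HasPolyRankBound K x d := hasPolyRankBound_of_finrank hxd
  have hbound : HasPolyRankBound K (⟨x, hmem⟩ : IntermediateField.adjoin K {x}) 1 :=
    .of_tower (M := M) (by rw [one_mul, hxd]) hxd'
  have := finiteDimensional_boundedPoles hx'.ne_zero' hbound n
  simpa using succ_le_finrank_boundedPoles hx' n

theorem HasControlledGrowth.adjoin [IsAlgClosed K] (hx : x ≠ 0) (hd : 0 < d)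
    (hxd : HasPolyRankBound K x d) {e : ℕ} {E : IntermediateField K M}
    (h : HasControlledGrowth x d e E) {g : M} (hg : g ≠ 0) (hgd : HasPolyRankBound K g d) :
    HasControlledGrowth x d
      (Module.finrank E (IntermediateField.adjoin E {g}) * e)
      ((IntermediateField.adjoin E {g}).restrictScalars K) := by
  set F₂ := IntermediateField.adjoin E {g} with hF₂
  set m := Module.finrank E F₂ with hm
  have : FiniteDimensional E M :=
    Module.finite_of_finrank_pos (pos_of_mul_pos_right (h.mul_finrank ▸ hd) (Nat.zero_le e))
  have he : 0 < e := pos_of_mul_pos_left (h.mul_finrank ▸ hd) (Nat.zero_le _)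
  have hmul : m * e * Module.finrank F₂ M = d := by
    rw [mul_comm m e, mul_assoc, Module.finrank_mul_finrank, h.mul_finrank]
  have hgmem : g ∈ F₂ := IntermediateField.mem_adjoin_simple_self E g
  have hli : LinearIndependent E fun j : Fin m => (⟨g, hgmem⟩ : F₂) ^ (j : ℕ) := by
    have hdeg : (minpoly E (⟨g, hgmem⟩ : F₂)).natDegree = m := by
      rw [← minpoly.algebraMap_eq (algebraMap F₂ M).injective,
        IntermediateField.algebraMap_apply, hm,
        IntermediateField.adjoin.finrank (Algebra.IsIntegral.isIntegral g)]
    exact hdeg ▸ linearIndependent_pow (K := E) (⟨g, hgmem⟩ : F₂)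
  have : IsScalarTower K F₂ M := .of_algebraMap_eq fun _ => rfl
  refine ⟨F₂.algebraMap_mem ⟨x, h.mem⟩, hmul, fun n => ?_⟩
  exact mul_add_one_le_finrank_boundedPoles (x := (⟨x, h.mem⟩ : E)) (g := (⟨g, hgmem⟩ : F₂))
    (fun h0 => hx (congrArg Subtype.val h0)) (fun h0 => hg (congrArg Subtype.val h0)) he
    Module.finrank_pos hli (h.hasPolyRankBound hd hxd h.mem) (.of_tower (M := M) hmul hxd)
    (.of_tower (M := M) hmul hgd) (h.le_finrank n)

theorem exists_hasControlledGrowth_adjoin [IsAlgClosed K] (hx : Transcendental K x) (hd : 0 < d)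
    (hxd : Module.finrank (IntermediateField.adjoin K {x}) M = d) {S : Set M} (hxS : x ∈ S)
    (hS : ∀ g ∈ S, g ≠ 0 ∧ HasPolyRankBound K g d) :
    ∃ e, HasControlledGrowth x d e (IntermediateField.adjoin K S) := by
  classical
  have hbdd : ∀ e (E : IntermediateField K M), HasControlledGrowth x d e E → e ≤ d :=
    fun e E h => Nat.le_of_dvd hd ⟨_, h.mul_finrank.symm⟩
  let p : ℕ → Prop := fun e =>
    ∃ E ≤ IntermediateField.adjoin K S, HasControlledGrowth x d e E
  have hp1 : p 1 := ⟨_, IntermediateField.adjoin.mono _ _ _ (Set.singleton_subset_iff.2 hxS),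
    hasControlledGrowth_adjoin hx hd hxd⟩
  obtain ⟨E, hE, h⟩ : p (Nat.findGreatest p d) :=
    Nat.findGreatest_spec (hbdd _ _ (hasControlledGrowth_adjoin hx hd hxd)) hp1
  set e := Nat.findGreatest p d
  refine ⟨e, (?_ : E = IntermediateField.adjoin K S) ▸ h⟩
  refine le_antisymm hE (IntermediateField.adjoin_le_iff.2 fun g hg => ?_)
  have h' := h.adjoin hx.ne_zero' hd (hS x hxS).2 (hS g hg).1 (hS g hg).2
  have hle : Module.finrank E (IntermediateField.adjoin E {g}) * e ≤ e := by
    refine Nat.le_findGreatest (hbdd _ _ h') ⟨_, fun z hz => ?_, h'⟩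
    have : IntermediateField.adjoin E {g} ≤ IntermediateField.extendScalars hE := by
      rw [IntermediateField.adjoin_le_iff, Set.singleton_subset_iff]
      exact IntermediateField.subset_adjoin K S hg
    exact this hz
  have he : 0 < e := pos_of_mul_pos_left (h.mul_finrank ▸ hd) (Nat.zero_le _)
  have : FiniteDimensional E M :=
    Module.finite_of_finrank_pos (pos_of_mul_pos_right (h.mul_finrank ▸ hd) (Nat.zero_le e))
  have hone : Module.finrank E (IntermediateField.adjoin E {g}) = 1 :=
    le_antisymm (Nat.le_of_mul_le_mul_right (by rwa [one_mul]) he) Module.finrank_pos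
  rw [IntermediateField.finrank_adjoin_simple_eq_one_iff, IntermediateField.mem_bot] at hone
  obtain ⟨a, rfl⟩ := hone
  exact a.2

end Maximal

section FunctionField

variable {K F : Type*} [Field K] [Field F] [Algebra K F]

theorem IsFunctionField.finiteDimensional (hF : IsFunctionField K F) {y : F}
    (hy : Transcendental K y) : FiniteDimensional (IntermediateField.adjoin K {y}) F := by
  obtain ⟨x, hx, hfin⟩ := hF
  let Kyx := IntermediateField.restrictScalars K
    (IntermediateField.adjoin (IntermediateField.adjoin K {y}) {x})
  let Kxy := IntermediateField.restrictScalars K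
    (IntermediateField.adjoin (IntermediateField.adjoin K {x}) {y})
  let : Algebra (IntermediateField.adjoin K {y}) Kyx :=
    (IntermediateField.adjoin (IntermediateField.adjoin K {y}) {x}).algebra
  let : Module (IntermediateField.adjoin K {y}) Kyx := Algebra.toModule
  let : Algebra (IntermediateField.adjoin K {x}) Kxy :=
    (IntermediateField.adjoin (IntermediateField.adjoin K {x}) {y}).algebra
  let : Module (IntermediateField.adjoin K {x}) Kxy := Algebra.toModule
  have hxy : IsAlgebraic (IntermediateField.adjoin K {y}) x :=
    IntermediateField.isAlgebraic_adjoin_iff.2 (.adjoin_singleton hx hy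
      (IntermediateField.isAlgebraic_adjoin_iff.1 (Algebra.IsAlgebraic.isAlgebraic y)))
  have : FiniteDimensional (IntermediateField.adjoin K {y}) Kyx :=
    IntermediateField.adjoin.finiteDimensional (isAlgebraic_iff_isIntegral.1 hxy)
  have : FiniteDimensional Kyx F := by
    unfold Kyx
    rw [IntermediateField.adjoin_simple_comm]
    have : IsScalarTower (IntermediateField.adjoin K {x}) Kxy F :=
      IntermediateField.isScalarTower_mid'
        (IntermediateField.adjoin (IntermediateField.adjoin K {x}) {y})
    exact .right (IntermediateField.adjoin K {x}) Kxy F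
  have : IsScalarTower (IntermediateField.adjoin K {y}) Kyx F :=
    IntermediateField.isScalarTower_mid'
      (IntermediateField.adjoin (IntermediateField.adjoin K {y}) {x})
  exact .trans (IntermediateField.adjoin K {y}) Kyx F

theorem IsFunctionField.exists_finrank_eq_gonality (hF : IsFunctionField K F) :
    0 < gonality K F ∧ ∃ f : F, Transcendental K f ∧
      Module.finrank (IntermediateField.adjoin K {f}) F = gonality K F := by
  obtain ⟨f, hf, hfin⟩ : gonality K F ∈ {d : ℕ | ∃ f : F, Transcendental K f ∧
      Module.finrank (IntermediateField.adjoin K {f}) F = d} :=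
    Nat.sInf_mem ⟨_, hF.choose, hF.choose_spec.1, rfl⟩
  have := hF.finiteDimensional hf
  exact ⟨hfin ▸ Module.finrank_pos, f, hf, hfin⟩

theorem exists_transcendental_of_finiteDimensional {x : F} (hx : Transcendental K x)
    (E : IntermediateField K F) [FiniteDimensional E F] : ∃ y : E, Transcendental K y := by
  by_contra! h
  have : Algebra.IsAlgebraic K E := ⟨fun y => not_not.1 (h y)⟩
  have : Algebra.IsAlgebraic K F := .trans K E F
  exact hx (Algebra.IsAlgebraic.isAlgebraic x)

theorem IsFunctionField.of_isPushout {k L N : Type*} [Field k] [Field L] [Field N] [Algebra k L]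
    [Algebra k F] [Algebra k N] [Algebra L N] [Algebra F N] [IsScalarTower k L N]
    [IsScalarTower k F N] [Algebra.IsAlgebraic k L] [Algebra.IsPushout k L F N]
    (hF : IsFunctionField k F) : IsFunctionField L N := by
  obtain ⟨x, hx, hfin⟩ := hF
  have : Algebra.IsPushout k F L N := .symm inferInstance
  refine ⟨algebraMap F N x, .extendScalars L
    ((transcendental_algebraMap_iff (algebraMap F N).injective).2 hx), ?_⟩
  refine .of_finrank_pos ?_
  rw [finrank_adjoin_singleton_eq (k := k)]
  exact Module.finrank_pos

end FunctionField

section Conjugation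

variable {k Ω F M : Type*} [Field k] [Field Ω] [Field F] [Field M] [Algebra k Ω] [Algebra k F]
  [Algebra k M] [Algebra Ω M] [Algebra F M] [IsScalarTower k Ω M] [IsScalarTower k F M]

theorem conjugation_mul_apply [Algebra.IsPushout k F Ω M] (σ τ : Ω ≃ₐ[k] Ω) (m : M) :
    conjugation F M (σ * τ) m = conjugation F M σ (conjugation F M τ m) := by
  have : Algebra.IsPushout k Ω F M := .symm inferInstance
  refine Algebra.IsPushout.induction_on k Ω F (motive := fun m =>
    conjugation F M (σ * τ) m = conjugation F M σ (conjugation F M τ m)) m (fun s t => ?_)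
    fun x y hx hy => ?_
  · simp [conjugation_algebraMap]
  · simp [hx, hy]

theorem conjugation_one_apply [Algebra.IsPushout k F Ω M] (m : M) :
    conjugation F M (1 : Ω ≃ₐ[k] Ω) m = m :=
  (conjugation F M (1 : Ω ≃ₐ[k] Ω)).injective (by rw [← conjugation_mul_apply, one_mul])

theorem conjugation_aeval [Algebra.IsPushout k F Ω M] (σ : Ω ≃ₐ[k] Ω) (m : M) (p : Polynomial Ω) :
    conjugation F M σ (aeval m p) =
      aeval (conjugation F M σ m) (p.map (σ : Ω →+* Ω)) := by
  induction p using Polynomial.induction_on' with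
  | add p q hp hq => simp [hp, hq]
  | monomial n a => simp [aeval_monomial, conjugation_algebraMap]

theorem HasPolyRankBound.conjugation [Algebra.IsPushout k F Ω M] {m : M} {d : ℕ}
    (h : HasPolyRankBound Ω m d) (σ : Ω ≃ₐ[k] Ω) :
    HasPolyRankBound Ω (conjugation F M σ m) d := by
  intro n hn v
  obtain ⟨c, hc, hsum⟩ := h hn fun i => (_root_.conjugation F M σ).symm (v i)
  refine ⟨fun i => (c i).map (σ : Ω →+* Ω), fun h0 => hc (funext fun i => ?_), ?_⟩
  · exact (Polynomial.map_eq_zero_iff (f := (σ : Ω →+* Ω)) σ.injective).1 (congrFun h0 i)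
  · simpa [conjugation_aeval] using congrArg (_root_.conjugation F M σ) hsum

theorem conjugation_mem_adjoin_range [Algebra.IsPushout k F Ω M] (f : M) (τ : Ω ≃ₐ[k] Ω) {m : M}
    (hm : m ∈ IntermediateField.adjoin Ω
      (Set.range fun σ : Ω ≃ₐ[k] Ω => conjugation F M σ f)) :
    conjugation F M τ m ∈ IntermediateField.adjoin Ω
      (Set.range fun σ : Ω ≃ₐ[k] Ω => conjugation F M σ f) := by
  induction hm using IntermediateField.adjoin_induction with
  | mem x hx =>
    obtain ⟨σ, rfl⟩ := hx
    exact IntermediateField.subset_adjoin _ _ ⟨τ * σ, conjugation_mul_apply τ σ f⟩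
  | algebraMap a => rw [conjugation_algebraMap]; exact IntermediateField.algebraMap_mem _ _
  | add x y _ _ hx hy => rw [map_add]; exact add_mem hx hy
  | inv x _ hx => rw [map_inv₀]; exact inv_mem hx
  | mul x y _ _ hx hy => rw [map_mul]; exact mul_mem hx hy

/-- A conjugation-stable subfield of a base change descends, together with the bound on its genus
coming from controlled growth. -/
theorem exists_isDControlled_of_conjugation_stable [IsAlgClosed Ω] [IsGalois k Ω]
    [Algebra.IsPushout k Ω F M] [Algebra.IsPushout k F Ω M] (hF : IsFunctionField k F) {f : M}
    {d e : ℕ} (hd : 0 < d) (hf : Transcendental Ω f) (hfd : HasPolyRankBound Ω f d)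
    {E' : IntermediateField Ω M} (h : HasControlledGrowth f d e E')
    (hE' : ∀ σ : Ω ≃ₐ[k] Ω, ∀ m ∈ E', conjugation F M σ m ∈ E') :
    ∃ E : IntermediateField k F, IsDControlled k F d E := by
  let E : IntermediateField k F :=
    (E'.restrictScalars k).comap (IsScalarTower.toAlgHom k F M)
  have hspan : ∀ m ∈ E', m ∈ Submodule.span Ω (algebraMap F M '' E) := fun m hm =>
    mem_span_of_conjugation_stable (Subalgebra.toSubmodule E'.toSubalgebra) hE' hm
  have hrank : Module.finrank E F = Module.finrank E' M :=
    finrank_eq_of_isPushout (fun a ha => ha) hspan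
  have he : e * Module.finrank E F = d := hrank ▸ h.mul_finrank
  have hEF : FiniteDimensional E F :=
    Module.finite_of_finrank_pos (pos_of_mul_pos_right (he ▸ hd) (Nat.zero_le e))
  refine ⟨E, e, Nat.pos_of_mul_pos_right (he ▸ hd), he, ?_⟩
  obtain ⟨x, hx, -⟩ := id hF
  obtain ⟨y, hy⟩ := exists_transcendental_of_finiteDimensional hx E
  have hyF : Transcendental k (algebraMap E F y) :=
    (transcendental_algebraMap_iff (algebraMap E F).injective).2 hy
  have := hF.finiteDimensional hyF
  have hyE : HasPolyRankBound k y
      (Module.finrank (IntermediateField.adjoin k {algebraMap E F y}) F) := by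
    intro n hn
    exact HasPolyRankBound.of_tower (M := F) rfl (fun m hm => hasPolyRankBound_of_finrank rfl
      (lt_of_le_of_lt (Nat.le_mul_of_pos_right _ Module.finrank_pos) hm)) hn
  let : Algebra E E' := (((algebraMap F M).comp (algebraMap E F)).codRestrict
    E'.toSubalgebra.toSubring fun a => a.2).toAlgebra
  have hcomm : ∀ a : E, algebraMap E' M (algebraMap E E' a) = algebraMap F M (algebraMap E F a) :=
    fun a => rfl
  have : IsScalarTower k E E' := .of_algebraMap_eq fun a => Subtype.ext
    (IsScalarTower.algebraMap_apply k F M a)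
  have : Algebra.IsPushout k Ω E E' := .of_mem_span (F := F) (M := M) hcomm fun m => by
    have himage : algebraMap F M '' E = E'.val.toLinearMap '' Set.range (algebraMap E E') := by
      rw [← Set.range_comp, Set.image_eq_range]
      rfl
    have hm := hspan m m.2
    rw [himage, ← Submodule.map_span] at hm
    obtain ⟨m', hm', heq⟩ := hm
    rwa [← Subtype.ext heq]
  have : Algebra.IsPushout k E Ω E' := .symm inferInstance
  have hf' : Transcendental Ω (⟨f, h.mem⟩ : E') :=
    (transcendental_algebraMap_iff (algebraMap E' M).injective).1 hf
  have hdef : HasPolarDefect Ω (⟨f, h.mem⟩ : E') ((e - 1) ^ 2) :=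
    hasPolarDefect_of_forall_le_finrank hf' (h.hasPolyRankBound hd hfd h.mem) h.le_finrank
  exact genus_le_of_hasPolarDefect
    ((hdef.of_transcendental hf' (h.hasPolyRankBound hd hfd h.mem) _).of_isPushout) hy hyE

theorem exists_isDControlled_of_transcendental [IsAlgClosed Ω] [IsGalois k Ω]
    [Algebra.IsPushout k Ω F M] [Algebra.IsPushout k F Ω M] (hF : IsFunctionField k F) {f : M}
    {d : ℕ} (hd : 0 < d) (hf : Transcendental Ω f)
    (hfd : Module.finrank (IntermediateField.adjoin Ω {f}) M = d) :
    ∃ E : IntermediateField k F, IsDControlled k F d E := by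
  have : FiniteDimensional (IntermediateField.adjoin Ω {f}) M :=
    Module.finite_of_finrank_pos (hfd ▸ hd)
  have hfd' : HasPolyRankBound Ω f d := hasPolyRankBound_of_finrank hfd
  obtain ⟨e, h⟩ := exists_hasControlledGrowth_adjoin hf hd hfd
    (S := Set.range fun σ : Ω ≃ₐ[k] Ω => conjugation F M σ f) ⟨1, conjugation_one_apply f⟩ (by
      rintro _ ⟨σ, rfl⟩
      exact ⟨by simpa using hf.ne_zero', hfd'.conjugation σ⟩)
  exact exists_isDControlled_of_conjugation_stable hF hd hf hfd' h
    fun τ _ => conjugation_mem_adjoin_range f τ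

end Conjugation

theorem exists_isDControlled_gonality_of_isPushout {k Ω F M L N : Type*} [Field k] [Field Ω]
    [Field F] [Field M] [Field L] [Field N] [Algebra k Ω] [Algebra k F] [Algebra k M] [Algebra Ω M]
    [Algebra F M] [IsScalarTower k Ω M] [IsScalarTower k F M] [Algebra k L] [Algebra k N]
    [Algebra L N] [Algebra F N] [IsScalarTower k L N] [IsScalarTower k F N] [IsAlgClosed Ω]
    [IsGalois k Ω] [Algebra.IsAlgebraic k L] [Algebra.IsPushout k Ω F M]
    [Algebra.IsPushout k L F N] (hF : IsFunctionField k F) :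
    ∃ E : IntermediateField k F, IsDControlled k F (gonality L N) E := by
  have : Algebra.IsPushout k F Ω M := .symm inferInstance
  obtain ⟨hpos, f, hf, hfd⟩ :=
    (hF.of_isPushout (L := L) (N := N)).exists_finrank_eq_gonality
  let i : L →ₐ[k] Ω := IsAlgClosed.lift
  let j : N →ₐ[k] M := Algebra.pushoutDesc N ((IsScalarTower.toAlgHom k Ω M).comp i)
    (IsScalarTower.toAlgHom k F M) fun _ _ => mul_comm _ _
  let : Algebra L Ω := i.toAlgebra
  let : Algebra N M := j.toAlgebra
  let : Algebra L M := ((algebraMap Ω M).comp (algebraMap L Ω)).toAlgebra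
  have : IsScalarTower k L Ω := .of_algebraMap_eq fun a => (i.commutes a).symm
  have : IsScalarTower k N M := .of_algebraMap_eq fun a => (j.commutes a).symm
  have : IsScalarTower L Ω M := .of_algebraMap_eq fun _ => rfl
  have : IsScalarTower L N M := .of_algebraMap_eq fun a =>
    (Algebra.pushoutDesc_left N ((IsScalarTower.toAlgHom k Ω M).comp i)
      (IsScalarTower.toAlgHom k F M) (fun _ _ => mul_comm _ _) a).symm
  have : IsScalarTower F N M := .of_algebraMap_eq fun a =>
    (Algebra.pushoutDesc_right N ((IsScalarTower.toAlgHom k Ω M).comp i)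
      (IsScalarTower.toAlgHom k F M) (fun _ _ => mul_comm _ _) a).symm
  have : Algebra.IsPushout L Ω N M := (Algebra.IsPushout.comp_iff k L F N).1 inferInstance
  have : Algebra.IsPushout L N Ω M := .symm inferInstance
  have : Algebra.IsAlgebraic L Ω := .tower_top (K := k) L
  refine exists_isDControlled_of_transcendental (f := algebraMap N M f) hF hpos
    (.extendScalars Ω
      ((transcendental_algebraMap_iff (R := L) (algebraMap N M).injective).2 hf)) ?_
  rw [finrank_adjoin_singleton_eq (k := L), hfd]

open TensorProduct in
theorem exists_isDControlled_gonality_of_isFractionRing {k Ω F M L N : Type*} [Field k] [Field Ω]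
    [Field F] [Field M] [Field L] [Field N] [Algebra k Ω] [Algebra k F] [Algebra k L]
    [IsAlgClosed Ω] [IsGalois k Ω] [Algebra.IsAlgebraic k L] [Algebra (Ω ⊗[k] F) M]
    [IsFractionRing (Ω ⊗[k] F) M] [Algebra Ω M] [IsScalarTower Ω (Ω ⊗[k] F) M]
    [Algebra (L ⊗[k] F) N] [IsFractionRing (L ⊗[k] F) N] [Algebra L N]
    [IsScalarTower L (L ⊗[k] F) N] (hF : IsFunctionField k F) :
    ∃ E : IntermediateField k F, IsDControlled k F (gonality L N) E := by
  have : IsDomain (Ω ⊗[k] F) := (IsFractionRing.injective (Ω ⊗[k] F) M).isDomain _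
  have : IsDomain (L ⊗[k] F) := (IsFractionRing.injective (L ⊗[k] F) N).isDomain _
  let : Algebra k M := ((algebraMap Ω M).comp (algebraMap k Ω)).toAlgebra
  let : Algebra k N := ((algebraMap L N).comp (algebraMap k L)).toAlgebra
  let : Algebra F M := ((algebraMap (Ω ⊗[k] F) M).comp
    (Algebra.TensorProduct.includeRight (R := k) (A := Ω)).toRingHom).toAlgebra
  let : Algebra F N := ((algebraMap (L ⊗[k] F) N).comp
    (Algebra.TensorProduct.includeRight (R := k) (A := L)).toRingHom).toAlgebra
  have : IsScalarTower k Ω M := .of_algebraMap_eq fun _ => rfl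
  have : IsScalarTower k L N := .of_algebraMap_eq fun _ => rfl
  have : IsScalarTower k F M := .of_algebraMap_eq fun a =>
    (IsScalarTower.algebraMap_apply Ω (Ω ⊗[k] F) M (algebraMap k Ω a)).trans
      (congrArg (algebraMap (Ω ⊗[k] F) M) (Algebra.TensorProduct.includeRight.commutes a).symm)
  have : IsScalarTower k F N := .of_algebraMap_eq fun a =>
    (IsScalarTower.algebraMap_apply L (L ⊗[k] F) N (algebraMap k L a)).trans
      (congrArg (algebraMap (L ⊗[k] F) N) (Algebra.TensorProduct.includeRight.commutes a).symm)
  have : Algebra.IsPushout k Ω F M := isPushout_of_isFractionRing_tensorProduct fun _ => rfl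
  have : Algebra.IsPushout k L F N := isPushout_of_isFractionRing_tensorProduct fun _ => rfl
  exact exists_isDControlled_gonality_of_isPushout (Ω := Ω) (M := M) hF

/-- Tower theorem: let `X` be a geometrically integral curve over a perfect
field `k` with function field `F = k(X)`, let `L ⊇ k` be an algebraic field extension, and
let `d = γ_L(X)` be the `L`-gonality of `X` (the gonality of the function field
`Frac(L ⊗_k F)` of `X_L` over `L`).  Then `k(X)` has a `d`-controlled subfield: there is a
subfield `E` of `k(X)` containing `k` and a positive integer `e` with `[k(X) : E] = d/e` and
the genus of `E` at most `(e - 1)²`. -/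
theorem exists_isDControlled_of_gonality_baseChange
    (k F L : Type*) [Field k] [Field F] [Algebra k F] [PerfectField k]
    (hF : IsFunctionField k F)
    [IsDomain (TensorProduct k (AlgebraicClosure k) F)]
    [Field L] [Algebra k L] [Algebra.IsAlgebraic k L]
    [IsDomain (TensorProduct k L F)] :
    letI : Algebra L (FractionRing (TensorProduct k L F)) :=
      ((algebraMap (TensorProduct k L F) (FractionRing (TensorProduct k L F))).comp
        (algebraMap L (TensorProduct k L F))).toAlgebra
    ∃ E : IntermediateField k F,
      IsDControlled k F (gonality L (FractionRing (TensorProduct k L F))) E := by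
  let : Algebra L (FractionRing (TensorProduct k L F)) :=
    ((algebraMap (TensorProduct k L F) (FractionRing (TensorProduct k L F))).comp
      (algebraMap L (TensorProduct k L F))).toAlgebra
  have : @IsScalarTower L (TensorProduct k L F) (FractionRing (TensorProduct k L F)) _ _
      Algebra.toSMul := .of_algebraMap_eq fun _ => rfl
  exact exists_isDControlled_gonality_of_isFractionRing (Ω := AlgebraicClosure k)
    (M := FractionRing (TensorProduct k (AlgebraicClosure k) F)) hF
end
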